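/- arXiv:1611.02950 — 14 statements merged into one kernel-verified Lean document; each statement's English description precedes it below -/
import Mathlib

section
/- Let 0 < a < b be real numbers, let p and q be positive continuous probability density functions on [a,b] (i.e. p, q : [a,b] → ℝ are continuous, strictly positive, and ∫_a^b p(x) dx = ∫_a^b q(x) dx = 1), and suppose the ratio x ↦ p(x)/q(x) is monotone non-decreasing on [a,b]. Let g : [a,b] → ℝ be monotone non-decreasing. Then ∫_a^b g(x) p(x) dx ≥ ∫_a^b g(x) q(x) dx. -/
open MeasureTheory Set

theorem lemma1_monotone_likelihood_ratio
    (a b : ℝ) (ha : 0 < a) (hab : a < b)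
    (p q g : ℝ → ℝ)
    (hpc : ContinuousOn p (Icc a b)) (hqc : ContinuousOn q (Icc a b))
    (hppos : ∀ x ∈ Icc a b, 0 < p x) (hqpos : ∀ x ∈ Icc a b, 0 < q x)
    (hpint : ∫ x in a..b, p x = 1) (hqint : ∫ x in a..b, q x = 1)
    (hratio : MonotoneOn (fun x => p x / q x) (Icc a b))
    (hg : MonotoneOn g (Icc a b)) :
    ∫ x in a..b, g x * p x ≥ ∫ x in a..b, g x * q x := by
  have hu : uIcc a b = Icc a b := uIcc_of_le hab.le
  have hpi : IntervalIntegrable p volume a b := hpc.intervalIntegrable_of_Icc hab.le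
  have hqi : IntervalIntegrable q volume a b := hqc.intervalIntegrable_of_Icc hab.le
  have hgi : IntervalIntegrable g volume a b :=
    (hu ▸ hg : MonotoneOn g (uIcc a b)).intervalIntegrable
  have hgp : IntervalIntegrable (fun x => g x * p x) volume a b :=
    hgi.mul_continuousOn (hu ▸ hpc)
  have hgq : IntervalIntegrable (fun x => g x * q x) volume a b :=
    hgi.mul_continuousOn (hu ▸ hqc)
  have hzero : ∫ x in a..b, (p x - q x) = 0 := by
    rw [intervalIntegral.integral_sub hpi hqi, hpint, hqint, sub_self]
  obtain ⟨c, hc, hpq⟩ : ∃ c ∈ Icc a b, p c - q c = 0 := by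
    obtain ⟨c, hc, h⟩ := exists_eq_interval_average hab.ne (hu ▸ hpc.sub hqc)
    refine ⟨c, hu ▸ uIoo_subset_uIcc_self hc, h.trans ?_⟩
    simp only [interval_average_eq, Pi.sub_apply, hzero, smul_zero]
  have hratio_c : p c / q c = 1 := by
    rw [sub_eq_zero.mp hpq, div_self (hqpos c hc).ne']
  have hnonneg : 0 ≤ ∫ x in a..b, ((g x * p x - g x * q x) - g c * (p x - q x)) := by
    refine intervalIntegral.integral_nonneg hab.le fun x hx => ?_
    rw [← mul_sub, ← sub_mul]
    rcases le_total x c with hxc | hcx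
    · have h := hratio hx hc hxc
      simp only [hratio_c, div_le_one (hqpos x hx)] at h
      exact mul_nonneg_of_nonpos_of_nonpos (sub_nonpos.mpr (hg hx hc hxc)) (sub_nonpos.mpr h)
    · have h := hratio hc hx hcx
      simp only [hratio_c, one_le_div (hqpos x hx)] at h
      exact mul_nonneg (sub_nonneg.mpr (hg hc hx hcx)) (sub_nonneg.mpr h)
  rw [intervalIntegral.integral_sub (hgp.sub hgq) ((hpi.sub hqi).const_mul _),
    intervalIntegral.integral_const_mul, hzero, mul_zero, sub_zero,
    intervalIntegral.integral_sub hgp hgq] at hnonneg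
  exact sub_nonneg.mp hnonneg
end

section
/- Let 0 < a < b be real numbers, let p and q be positive continuous probability density functions on [a,b] (p, q : [a,b] → ℝ continuous, strictly positive, with ∫_a^b p(x) dx = ∫_a^b q(x) dx = 1). If g : [a,b] → ℝ is strictly increasing and x ↦ p(x)/q(x) is strictly increasing on [a,b], then ∫_a^b g(x) p(x) dx > ∫_a^b g(x) q(x) dx. -/
open MeasureTheory Set

/-- If two continuous functions, the second one positive, have equal integrals over `[a, b]` and
their quotient is strictly increasing, then they agree at some interior point. -/
lemma exists_mem_Ioo_eq_of_strictMonoOn_div {a b : ℝ} (hab : a < b) {p q : ℝ → ℝ}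
    (hpc : ContinuousOn p (Icc a b)) (hqc : ContinuousOn q (Icc a b))
    (hqpos : ∀ x ∈ Icc a b, 0 < q x) (hint : ∫ x in a..b, p x = ∫ x in a..b, q x)
    (hratio : StrictMonoOn (fun x => p x / q x) (Icc a b)) :
    ∃ c ∈ Ioo a b, p c = q c := by
  have hp := hpc.intervalIntegrable_of_Icc (μ := volume) hab.le
  have hq := hqc.intervalIntegrable_of_Icc (μ := volume) hab.le
  have hamem := left_mem_Icc.2 hab.le
  have hbmem := right_mem_Icc.2 hab.le
  have hleft : p a - q a < 0 := by
    by_contra! h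
    have hpos : 0 < ∫ x in a..b, p x - q x :=
      intervalIntegral.intervalIntegral_pos_of_pos_on (hp.sub hq) (fun x hx => by
        have hxm := Ioo_subset_Icc_self hx
        have h1 : 1 ≤ p a / q a := (one_le_div (hqpos a hamem)).2 (by linarith)
        have h2 : 1 < p x / q x := h1.trans_lt (hratio hamem hxm hx.1)
        linarith [(one_lt_div (hqpos x hxm)).1 h2]) hab
    rw [intervalIntegral.integral_sub hp hq] at hpos
    linarith
  have hright : 0 < p b - q b := by
    by_contra! h
    have hpos : 0 < ∫ x in a..b, q x - p x :=
      intervalIntegral.intervalIntegral_pos_of_pos_on (hq.sub hp) (fun x hx => by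
        have hxm := Ioo_subset_Icc_self hx
        have h1 : p b / q b ≤ 1 := (div_le_one (hqpos b hbmem)).2 (by linarith)
        have h2 : p x / q x < 1 := (hratio hxm hbmem hx.2).trans_le h1
        linarith [(div_lt_one (hqpos x hxm)).1 h2]) hab
    rw [intervalIntegral.integral_sub hq hp] at hpos
    linarith
  obtain ⟨c, hc, hc0⟩ := intermediate_value_Ioo hab.le (hpc.sub hqc) ⟨hleft, hright⟩
  exact ⟨c, hc, sub_eq_zero.1 hc0⟩

theorem lemma1_strict_variant
    (a b : ℝ) (ha : 0 < a) (hab : a < b)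
    (p q g : ℝ → ℝ)
    (hpc : ContinuousOn p (Icc a b)) (hqc : ContinuousOn q (Icc a b))
    (hppos : ∀ x ∈ Icc a b, 0 < p x) (hqpos : ∀ x ∈ Icc a b, 0 < q x)
    (hpint : ∫ x in a..b, p x = 1) (hqint : ∫ x in a..b, q x = 1)
    (hratio : StrictMonoOn (fun x => p x / q x) (Icc a b))
    (hg : StrictMonoOn g (Icc a b)) :
    ∫ x in a..b, g x * p x > ∫ x in a..b, g x * q x := by
  obtain ⟨c, hc, hpq⟩ := exists_mem_Ioo_eq_of_strictMonoOn_div hab hpc hqc hqpos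
    (hpint.trans hqint.symm) hratio
  have hcm := Ioo_subset_Icc_self hc
  have hp := hpc.intervalIntegrable_of_Icc (μ := volume) hab.le
  have hq := hqc.intervalIntegrable_of_Icc (μ := volume) hab.le
  have hab' : uIcc a b = Icc a b := uIcc_of_le hab.le
  have hgi : IntervalIntegrable g volume a b :=
    MonotoneOn.intervalIntegrable (by rw [hab']; exact hg.monotoneOn)
  have hgp : IntervalIntegrable (fun x => g x * p x) volume a b :=
    hgi.mul_continuousOn (by rwa [hab'])
  have hgq : IntervalIntegrable (fun x => g x * q x) volume a b :=
    hgi.mul_continuousOn (by rwa [hab'])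
  have hc1 : p c / q c = 1 := by rw [hpq, div_self (hqpos c hcm).ne']
  have hi : IntervalIntegrable (fun x => (g x * p x - g x * q x) - g c * (p x - q x))
      volume a b := (hgp.sub hgq).sub ((hp.sub hq).const_mul _)
  have hcu : c ∈ uIcc a b := by rwa [hab']
  have hi1 := hi.mono_set (uIcc_subset_uIcc_left hcu)
  have hi2 := hi.mono_set (uIcc_subset_uIcc_right hcu)
  have hpos1 := intervalIntegral.intervalIntegral_pos_of_pos_on hi1 (fun x hx => by
    have hxm : x ∈ Icc a b := ⟨hx.1.le, hx.2.le.trans hc.2.le⟩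
    have h1 : p x / q x < 1 := hc1 ▸ hratio hxm hcm hx.2
    have h2 := (div_lt_one (hqpos x hxm)).1 h1
    nlinarith [mul_pos (sub_pos.2 (hg hxm hcm hx.2)) (sub_pos.2 h2)]) hc.1
  have hpos2 := intervalIntegral.intervalIntegral_pos_of_pos_on hi2 (fun x hx => by
    have hxm : x ∈ Icc a b := ⟨hc.1.le.trans hx.1.le, hx.2.le⟩
    have h1 : 1 < p x / q x := hc1 ▸ hratio hcm hxm hx.1
    have h2 := (one_lt_div (hqpos x hxm)).1 h1
    nlinarith [mul_pos (sub_pos.2 (hg hcm hxm hx.1)) (sub_pos.2 h2)]) hc.2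
  have hpos := add_pos hpos1 hpos2
  rw [intervalIntegral.integral_add_adjacent_intervals hi1 hi2,
    intervalIntegral.integral_sub (hgp.sub hgq) ((hp.sub hq).const_mul _),
    intervalIntegral.integral_sub hgp hgq, intervalIntegral.integral_const_mul,
    intervalIntegral.integral_sub hp hq, hpint, hqint] at hpos
  linarith
end

section
/- Let f : (0,∞) → (0,∞) be continuous and suppose that u ↦ u·f(u) is monotone non-decreasing on (0,∞) (condition F2). Fix real numbers 0 < a < b. Define, for real τ > 0, D_{a,b}(τ) = (∫_a^b ∫_a^b f(x·y) (x·y)^(2−τ) dx dy) / (∫_a^b x^(1−τ) dx)^2. Then D_{a,b} is monotone non-increasing in τ on (0,∞); that is, for all 0 < τ₁ ≤ τ₂ one has D_{a,b}(τ₂) ≤ D_{a,b}(τ₁). -/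
open MeasureTheory Set

/-- Chebyshev's integral inequality for two weights `v`, `w` such that `v / w` is nonincreasing:
the `v`-average of a nondecreasing function is at most its `w`-average. -/
theorem MonotoneOn.integral_mul_mul_integral_le {a b : ℝ} (hab : a ≤ b) {g v w : ℝ → ℝ}
    (hg : MonotoneOn g (Icc a b)) (hv : ContinuousOn v (Icc a b)) (hw : ContinuousOn w (Icc a b))
    (hvw : ∀ x ∈ Icc a b, ∀ y ∈ Icc a b, x ≤ y → v y * w x ≤ v x * w y) :
    (∫ x in a..b, g x * v x) * (∫ x in a..b, w x) ≤
      (∫ x in a..b, g x * w x) * (∫ x in a..b, v x) := by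
  rw [← uIcc_of_le hab] at hg hv hw
  have iv : IntervalIntegrable v volume a b := hv.intervalIntegrable
  have iw : IntervalIntegrable w volume a b := hw.intervalIntegrable
  have igv : IntervalIntegrable (fun x => g x * v x) volume a b :=
    hg.intervalIntegrable.mul_continuousOn hv
  have igw : IntervalIntegrable (fun x => g x * w x) volume a b :=
    hg.intervalIntegrable.mul_continuousOn hw
  rw [uIcc_of_le hab] at hg
  set V := ∫ x in a..b, v x
  set W := ∫ x in a..b, w x
  set GV := ∫ x in a..b, g x * v x
  set GW := ∫ x in a..b, g x * w x
  have pointwise : ∀ x ∈ Icc a b, ∀ y ∈ Icc a b,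
      w y * (g x * v x) + g y * v y * w x ≤ v y * (g x * w x) + g y * w y * v x := by
    intro x hx y hy
    rcases le_total x y with h | h
    · nlinarith [mul_nonneg (sub_nonneg.2 (hg hx hy h)) (sub_nonneg.2 (hvw x hx y hy h))]
    · nlinarith [mul_nonneg (sub_nonneg.2 (hg hy hx h)) (sub_nonneg.2 (hvw y hy x hx h))]
  have inner : ∀ y ∈ Icc a b, GV * w y + W * (g y * v y) ≤ GW * v y + V * (g y * w y) := by
    intro y hy
    have h := intervalIntegral.integral_mono_on hab
      ((igv.const_mul (w y)).add (iw.const_mul (g y * v y)))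
      ((igw.const_mul (v y)).add (iv.const_mul (g y * w y)))
      (fun x hx => pointwise x hx y hy)
    rw [intervalIntegral.integral_add (igv.const_mul _) (iw.const_mul _),
      intervalIntegral.integral_add (igw.const_mul _) (iv.const_mul _)] at h
    simp only [intervalIntegral.integral_const_mul] at h
    linarith
  have h := intervalIntegral.integral_mono_on hab
    ((iw.const_mul GV).add (igv.const_mul W)) ((iv.const_mul GW).add (igw.const_mul V)) inner
  rw [intervalIntegral.integral_add (iw.const_mul _) (igv.const_mul _),
    intervalIntegral.integral_add (iv.const_mul _) (igw.const_mul _)] at h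
  simp only [intervalIntegral.integral_const_mul] at h
  linarith

/-- The two-variable version: the average of `r (x * y)` against the product weight `v ⊗ v` is at
most its average against `w ⊗ w` if `r` is nondecreasing and `v / w` is nonincreasing. -/
theorem MonotoneOn.integral_integral_mul_le {a b : ℝ} (ha : 0 < a) (hab : a ≤ b) {r v w : ℝ → ℝ}
    (hr : MonotoneOn r (Ioi 0)) (hv : ContinuousOn v (Icc a b)) (hw : ContinuousOn w (Icc a b))
    (hv0 : ∀ x ∈ Icc a b, 0 ≤ v x) (hw0 : ∀ x ∈ Icc a b, 0 ≤ w x)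
    (hvw : ∀ x ∈ Icc a b, ∀ y ∈ Icc a b, x ≤ y → v y * w x ≤ v x * w y) :
    (∫ x in a..b, (∫ y in a..b, r (x * y) * v y) * v x) * (∫ x in a..b, w x) ^ 2 ≤
      (∫ x in a..b, (∫ y in a..b, r (x * y) * w y) * w x) * (∫ x in a..b, v x) ^ 2 := by
  have pos : ∀ x ∈ Icc a b, 0 < x := fun x hx => ha.trans_le hx.1
  have section_mono : ∀ x ∈ Icc a b, MonotoneOn (fun y => r (x * y)) (Icc a b) :=
    fun x hx y hy z hz hyz => hr (mul_pos (pos x hx) (pos y hy)) (mul_pos (pos x hx) (pos z hz))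
      (mul_le_mul_of_nonneg_left hyz (pos x hx).le)
  have integral_mono : ∀ u : ℝ → ℝ, ContinuousOn u (Icc a b) → (∀ x ∈ Icc a b, 0 ≤ u x) →
      MonotoneOn (fun x => ∫ y in a..b, r (x * y) * u y) (Icc a b) := by
    intro u hu hu0 x hx z hz hxz
    have integrable : ∀ t ∈ Icc a b,
        IntervalIntegrable (fun y => r (t * y) * u y) volume a b := fun t ht => by
      have h := section_mono t ht
      rw [← uIcc_of_le hab] at h hu
      exact h.intervalIntegrable.mul_continuousOn hu
    refine intervalIntegral.integral_mono_on hab (integrable x hx) (integrable z hz) fun y hy => ?_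
    exact mul_le_mul_of_nonneg_right (hr (mul_pos (pos x hx) (pos y hy))
      (mul_pos (pos z hz) (pos y hy)) (mul_le_mul_of_nonneg_right hxz (pos y hy).le)) (hu0 y hy)
  have integrable : ∀ u : ℝ → ℝ, ContinuousOn u (Icc a b) → (∀ x ∈ Icc a b, 0 ≤ u x) →
      IntervalIntegrable (fun x => (∫ y in a..b, r (x * y) * u y) * v x) volume a b := by
    intro u hu hu0
    have h := integral_mono u hu hu0
    rw [← uIcc_of_le hab] at h hv
    exact h.intervalIntegrable.mul_continuousOn hv
  have hV : 0 ≤ ∫ x in a..b, v x := intervalIntegral.integral_nonneg hab hv0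
  have hW : 0 ≤ ∫ x in a..b, w x := intervalIntegral.integral_nonneg hab hw0
  have outer := (integral_mono w hw hw0).integral_mul_mul_integral_le hab hv hw hvw
  have inner : (∫ x in a..b, (∫ y in a..b, r (x * y) * v y) * v x) * (∫ x in a..b, w x) ≤
      (∫ x in a..b, (∫ y in a..b, r (x * y) * w y) * v x) * (∫ x in a..b, v x) := by
    rw [← intervalIntegral.integral_mul_const, ← intervalIntegral.integral_mul_const]
    refine intervalIntegral.integral_mono_on hab ((integrable v hv hv0).mul_const _)
      ((integrable w hw hw0).mul_const _) fun x hx => ?_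
    have h := mul_le_mul_of_nonneg_right
      ((section_mono x hx).integral_mul_mul_integral_le hab hv hw hvw) (hv0 x hx)
    linarith
  have h₁ := mul_le_mul_of_nonneg_right inner hW
  have h₂ := mul_le_mul_of_nonneg_right outer hV
  linarith

theorem D_antitone_in_tau
    (f : ℝ → ℝ)
    (hfc : ContinuousOn f (Ioi 0))
    (hfpos : ∀ u ∈ Ioi (0:ℝ), 0 < f u)
    (huf : MonotoneOn (fun u => u * f u) (Ioi 0))
    (a b : ℝ) (ha : 0 < a) (hab : a < b)
    (D : ℝ → ℝ)
    (hD : ∀ τ : ℝ, D τ =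
      (∫ x in a..b, ∫ y in a..b, f (x * y) * (x * y) ^ (2 - τ)) /
        (∫ x in a..b, x ^ (1 - τ)) ^ 2) :
    ∀ τ₁ τ₂ : ℝ, 0 < τ₁ → τ₁ ≤ τ₂ → D τ₂ ≤ D τ₁ := by
  intro τ₁ τ₂ _ hτ
  have pos : ∀ x ∈ Icc a b, 0 < x := fun x hx => ha.trans_le hx.1
  have cont : ∀ τ : ℝ, ContinuousOn (fun x : ℝ => x ^ (1 - τ)) (Icc a b) := fun τ x hx =>
    (Real.continuousAt_rpow_const x _ (Or.inl (pos x hx).ne')).continuousWithinAt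
  have weight_nonneg : ∀ τ : ℝ, ∀ x ∈ Icc a b, 0 ≤ x ^ (1 - τ) := fun τ x hx =>
    Real.rpow_nonneg (pos x hx).le _
  have weight_integral_pos : ∀ τ : ℝ, 0 < ∫ x in a..b, x ^ (1 - τ) := fun τ =>
    intervalIntegral.intervalIntegral_pos_of_pos_on
      ((cont τ).intervalIntegrable_of_Icc hab.le)
      (fun x hx => Real.rpow_pos_of_pos (pos x (Ioo_subset_Icc_self hx)) _) hab
  have numerator : ∀ τ : ℝ, (∫ x in a..b, ∫ y in a..b, f (x * y) * (x * y) ^ (2 - τ)) =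
      ∫ x in a..b, (∫ y in a..b, (x * y * f (x * y)) * y ^ (1 - τ)) * x ^ (1 - τ) := by
    intro τ
    refine intervalIntegral.integral_congr fun x hx => ?_
    rw [uIcc_of_le hab.le] at hx
    simp only [← intervalIntegral.integral_mul_const]
    refine intervalIntegral.integral_congr fun y hy => ?_
    rw [uIcc_of_le hab.le] at hy
    have hx0 := pos x hx
    have hy0 := pos y hy
    rw [show 2 - τ = 1 + (1 - τ) by ring, Real.rpow_add (mul_pos hx0 hy0), Real.rpow_one,
      Real.mul_rpow hx0.le hy0.le]
    ring
  have ratio : ∀ x ∈ Icc a b, ∀ y ∈ Icc a b, x ≤ y →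
      y ^ (1 - τ₂) * x ^ (1 - τ₁) ≤ x ^ (1 - τ₂) * y ^ (1 - τ₁) := by
    intro x hx y hy hxy
    have hx0 := pos x hx
    have hy0 := pos y hy
    rw [show 1 - τ₁ = (1 - τ₂) + (τ₂ - τ₁) by ring, Real.rpow_add hx0, Real.rpow_add hy0]
    have h := mul_le_mul_of_nonneg_left
      (Real.rpow_le_rpow hx0.le hxy (sub_nonneg.2 hτ))
      (mul_nonneg (Real.rpow_nonneg hx0.le (1 - τ₂)) (Real.rpow_nonneg hy0.le (1 - τ₂)))
    linarith
  rw [hD, hD, div_le_div_iff₀ (pow_pos (weight_integral_pos τ₂) 2)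
    (pow_pos (weight_integral_pos τ₁) 2), numerator, numerator]
  exact huf.integral_integral_mul_le ha hab.le (cont τ₂) (cont τ₁) (weight_nonneg τ₂)
    (weight_nonneg τ₁) ratio
end

section
/- Let f : (0,∞) → (0,∞) be continuous, and suppose there exist real numbers u₀ > ε > 0 such that u ↦ u·f(u) is strictly decreasing on the interval [u₀−ε, u₀+ε]. Set a = (u₀−ε)^(1/2) and b = (u₀+ε)^(1/2), and define for real τ: D_{a,b}(τ) = (∫_a^b ∫_a^b f(x·y) (x·y)^(2−τ) dx dy) / (∫_a^b x^(1−τ) dx)^2. Then D_{a,b} is strictly increasing in τ; that is, for all real τ₁ < τ₂ one has D_{a,b}(τ₁) < D_{a,b}(τ₂). -/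
open MeasureTheory Set

/-- Strict Chebyshev inequality: tilting the weight `v` by an increasing factor `r` decreases the
weighted average of a strictly decreasing function `h`. -/
theorem integral_mul_lt_of_strictAntiOn {a b : ℝ} (hab : a < b) {r v h : ℝ → ℝ}
    (hr : ContinuousOn r (Icc a b)) (hv : ContinuousOn v (Icc a b))
    (hh : ContinuousOn h (Icc a b)) (hvpos : ∀ x ∈ Icc a b, 0 < v x)
    (hrmono : StrictMonoOn r (Icc a b)) (hanti : StrictAntiOn h (Icc a b)) :
    (∫ x in a..b, r x * v x * h x) * (∫ x in a..b, v x) <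
      (∫ x in a..b, v x * h x) * ∫ x in a..b, r x * v x := by
  have hvi : 0 < ∫ x in a..b, v x :=
    intervalIntegral.intervalIntegral_pos_of_pos_on (hv.intervalIntegrable_of_Icc hab.le)
      (fun x hx => hvpos x (Ioo_subset_Icc_self hx)) hab
  obtain ⟨c, hc, hrc⟩ := exists_eq_const_mul_intervalIntegral_of_nonneg (μ := volume) (f := r)
    (g := v) (by rwa [uIcc_of_le hab.le]) (hv.intervalIntegrable_of_Icc hab.le)
    (fun x hx => (hvpos x (by
      rw [uIoc_of_le hab.le] at hx
      exact Ioc_subset_Icc_self hx)).le)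
  rw [uIcc_of_le hab.le] at hc
  have hneg : ∀ x ∈ Icc a b, x ≠ c → (r x - r c) * (h x - h c) < 0 := by
    intro x hx hxc
    rcases lt_or_gt_of_ne hxc with hlt | hgt
    · exact mul_neg_of_neg_of_pos (sub_neg.2 (hrmono hx hc hlt)) (sub_pos.2 (hanti hx hc hlt))
    · exact mul_neg_of_pos_of_neg (sub_pos.2 (hrmono hc hx hgt)) (sub_neg.2 (hanti hc hx hgt))
  have hcomp : (∫ x in a..b, (r x * v x * h x - r c * (v x * h x))) <
      ∫ x in a..b, h c * (r x * v x - r c * v x) := by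
    refine intervalIntegral.integral_lt_integral_of_continuousOn_of_le_of_exists_lt hab
      (by fun_prop) (by fun_prop) (fun x hx => ?_) ?_
    · have hx' := Ioc_subset_Icc_self hx
      rcases eq_or_ne x c with rfl | hxc
      · apply le_of_eq; ring
      · nlinarith [mul_neg_of_pos_of_neg (hvpos x hx') (hneg x hx' hxc)]
    · obtain ⟨x, hx, hxc⟩ : ∃ x ∈ Icc a b, x ≠ c := by
        rcases eq_or_ne a c with rfl | hac
        · exact ⟨b, right_mem_Icc.2 hab.le, hab.ne'⟩
        · exact ⟨a, left_mem_Icc.2 hab.le, hac⟩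
      exact ⟨x, hx, by nlinarith [mul_neg_of_pos_of_neg (hvpos x hx) (hneg x hx hxc)]⟩
  have hint : ∀ {φ : ℝ → ℝ}, ContinuousOn φ (Icc a b) → IntervalIntegrable φ volume a b :=
    fun hφ => hφ.intervalIntegrable_of_Icc hab.le
  rw [intervalIntegral.integral_sub (hint (by fun_prop)) (hint (by fun_prop)),
    intervalIntegral.integral_const_mul, intervalIntegral.integral_const_mul,
    intervalIntegral.integral_sub (hint (by fun_prop)) (hint (by fun_prop)),
    intervalIntegral.integral_const_mul, hrc] at hcomp
  rw [hrc]
  nlinarith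

/-- Two-variable version of `integral_mul_lt_of_strictAntiOn` for a kernel `K` that is strictly
decreasing in each variable. -/
theorem integral_integral_div_sq_lt_of_strictAntiOn {a b : ℝ} (hab : a < b) {r v : ℝ → ℝ}
    {K : ℝ → ℝ → ℝ} (hr : Continuous r) (hv : Continuous v) (hK : Continuous K.uncurry)
    (hrpos : ∀ x ∈ Icc a b, 0 < r x) (hvpos : ∀ x ∈ Icc a b, 0 < v x)
    (hrmono : StrictMonoOn r (Icc a b))
    (hleft : ∀ y ∈ Icc a b, StrictAntiOn (fun x => K x y) (Icc a b))
    (hright : ∀ x ∈ Icc a b, StrictAntiOn (K x) (Icc a b)) :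
    (∫ x in a..b, ∫ y in a..b, K x y * (r x * v x) * (r y * v y)) /
        (∫ x in a..b, r x * v x) ^ 2 <
      (∫ x in a..b, ∫ y in a..b, K x y * v x * v y) / (∫ x in a..b, v x) ^ 2 := by
  set H₁ : ℝ → ℝ := fun x => ∫ y in a..b, r y * v y * K x y with hH₁
  set H₂ : ℝ → ℝ := fun x => ∫ y in a..b, v y * K x y with hH₂
  set I₁ := ∫ x in a..b, r x * v x
  set I₂ := ∫ x in a..b, v x
  have hJ₁ : (∫ x in a..b, ∫ y in a..b, K x y * (r x * v x) * (r y * v y)) =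
      ∫ x in a..b, r x * v x * H₁ x := by
    refine intervalIntegral.integral_congr fun x _ => ?_
    simp only [hH₁, ← intervalIntegral.integral_const_mul]
    refine intervalIntegral.integral_congr fun y _ => ?_
    ring
  have hJ₂ : (∫ x in a..b, ∫ y in a..b, K x y * v x * v y) = ∫ x in a..b, v x * H₂ x := by
    refine intervalIntegral.integral_congr fun x _ => ?_
    simp only [hH₂, ← intervalIntegral.integral_const_mul]
    refine intervalIntegral.integral_congr fun y _ => ?_
    ring
  have hKx : ∀ x, Continuous (K x) := fun x => hK.comp (by fun_prop : Continuous fun y => (x, y))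
  have hH₁c : Continuous H₁ :=
    intervalIntegral.continuous_parametric_intervalIntegral_of_continuous'
      (((by fun_prop : Continuous fun p : ℝ × ℝ => r p.2 * v p.2)).mul hK) a b
  have hH₂c : Continuous H₂ :=
    intervalIntegral.continuous_parametric_intervalIntegral_of_continuous'
      (((by fun_prop : Continuous fun p : ℝ × ℝ => v p.2)).mul hK) a b
  have hI₁pos : 0 < I₁ :=
    intervalIntegral.intervalIntegral_pos_of_pos_on ((hr.mul hv).intervalIntegrable a b)
      (fun x hx => mul_pos (hrpos x (Ioo_subset_Icc_self hx)) (hvpos x (Ioo_subset_Icc_self hx)))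
      hab
  have hI₂pos : 0 < I₂ :=
    intervalIntegral.intervalIntegral_pos_of_pos_on (hv.intervalIntegrable a b)
      (fun x hx => hvpos x (Ioo_subset_Icc_self hx)) hab
  have hH₂anti : StrictAntiOn H₂ (Icc a b) := by
    intro x hx x' hx' hxx'
    have hlt : ∀ y ∈ Icc a b, v y * K x' y < v y * K x y := fun y hy =>
      mul_lt_mul_of_pos_left (hleft y hy hx hx' hxx') (hvpos y hy)
    exact intervalIntegral.integral_lt_integral_of_continuousOn_of_le_of_exists_lt hab
      (hv.mul (hKx x')).continuousOn (hv.mul (hKx x)).continuousOn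
      (fun y hy => (hlt y (Ioc_subset_Icc_self hy)).le)
      ⟨a, left_mem_Icc.2 hab.le, hlt a (left_mem_Icc.2 hab.le)⟩
  have hinner : ∀ x ∈ Icc a b, H₁ x * I₂ < H₂ x * I₁ := fun x hx =>
    integral_mul_lt_of_strictAntiOn hab hr.continuousOn hv.continuousOn (hKx x).continuousOn
      hvpos hrmono (hright x hx)
  have houter : (∫ x in a..b, r x * v x * H₂ x) * I₂ < (∫ x in a..b, v x * H₂ x) * I₁ :=
    integral_mul_lt_of_strictAntiOn hab hr.continuousOn hv.continuousOn hH₂c.continuousOn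
      hvpos hrmono hH₂anti
  have hmixed : (∫ x in a..b, r x * v x * H₁ x) * I₂ < (∫ x in a..b, r x * v x * H₂ x) * I₁ := by
    rw [← intervalIntegral.integral_mul_const, ← intervalIntegral.integral_mul_const]
    have hlt : ∀ x ∈ Icc a b, r x * v x * H₁ x * I₂ < r x * v x * H₂ x * I₁ := fun x hx => by
      rw [mul_assoc, mul_assoc (r x * v x)]
      exact mul_lt_mul_of_pos_left (hinner x hx) (mul_pos (hrpos x hx) (hvpos x hx))
    exact intervalIntegral.integral_lt_integral_of_continuousOn_of_le_of_exists_lt hab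
      (by fun_prop) (by fun_prop) (fun x hx => (hlt x (Ioc_subset_Icc_self hx)).le)
      ⟨a, left_mem_Icc.2 hab.le, hlt a (left_mem_Icc.2 hab.le)⟩
  rw [hJ₁, hJ₂, div_lt_div_iff₀ (by positivity) (by positivity)]
  nlinarith [mul_lt_mul_of_pos_right hmixed hI₂pos, mul_lt_mul_of_pos_right houter hI₁pos]

theorem D_strict_increasing_when_F2_fails
    (f : ℝ → ℝ)
    (hfc : ContinuousOn f (Ioi 0))
    (hfpos : ∀ u ∈ Ioi (0:ℝ), 0 < f u)
    (u₀ ε : ℝ) (hε : 0 < ε) (hu₀ : ε < u₀)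
    (hdec : StrictAntiOn (fun u => u * f u) (Icc (u₀ - ε) (u₀ + ε)))
    (a b : ℝ) (ha : a = Real.sqrt (u₀ - ε)) (hb : b = Real.sqrt (u₀ + ε))
    (D : ℝ → ℝ)
    (hD : ∀ τ : ℝ, D τ =
      (∫ x in a..b, ∫ y in a..b, f (x * y) * (x * y) ^ (2 - τ)) /
        (∫ x in a..b, x ^ (1 - τ)) ^ 2) :
    ∀ τ₁ τ₂ : ℝ, τ₁ < τ₂ → D τ₁ < D τ₂ := by
  intro τ₁ τ₂ hτ
  have ha0 : 0 < a := ha ▸ Real.sqrt_pos.2 (by linarith)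
  have hab : a < b := by
    rw [ha, hb]
    exact Real.sqrt_lt_sqrt (by linarith) (by linarith)
  have haa : a * a = u₀ - ε := by rw [ha, Real.mul_self_sqrt (by linarith)]
  have hbb : b * b = u₀ + ε := by rw [hb, Real.mul_self_sqrt (by linarith)]
  have hmaps : ∀ x ∈ Icc a b, ∀ y ∈ Icc a b, x * y ∈ Icc (u₀ - ε) (u₀ + ε) := by
    intro x hx y hy
    rw [← haa, ← hbb]
    have hx0 := ha0.le.trans hx.1
    exact ⟨mul_le_mul hx.1 hy.1 ha0.le hx0,
      mul_le_mul hx.2 hy.2 (ha0.le.trans hy.1) (hx0.trans hx.2)⟩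
  -- Clamping at `a` makes all integrands globally continuous without changing them on `[a, b]`.
  have hpos : ∀ x, 0 < max a x := fun x => lt_max_of_lt_left ha0
  have hclamp : ∀ x ∈ Icc a b, max a x = x := fun x hx => max_eq_right hx.1
  have hpow : ∀ s : ℝ, Continuous fun x => max a x ^ s := fun s =>
    (by fun_prop : Continuous fun x => max a x).rpow_const fun x => Or.inl (hpos x).ne'
  let K : ℝ → ℝ → ℝ := fun x y => max a x * max a y * f (max a x * max a y)
  have hKc : Continuous K.uncurry := by
    have hm : Continuous fun p : ℝ × ℝ => max a p.1 * max a p.2 := by fun_prop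
    exact hm.mul (hfc.comp_continuous hm fun p => mul_pos (hpos p.1) (hpos p.2))
  have hKeq : ∀ x ∈ Icc a b, ∀ y ∈ Icc a b, K x y = x * y * f (x * y) := fun x hx y hy => by
    simp only [K, hclamp x hx, hclamp y hy]
  have hright : ∀ x ∈ Icc a b, StrictAntiOn (K x) (Icc a b) := by
    intro x hx y hy y' hy' hyy'
    rw [hKeq x hx y hy, hKeq x hx y' hy']
    exact hdec (hmaps x hx y hy) (hmaps x hx y' hy')
      (mul_lt_mul_of_pos_left hyy' (ha0.trans_le hx.1))
  have hsymm : ∀ x y, K x y = K y x := fun x y => by simp only [K, mul_comm (max a x)]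
  have hrmono : StrictMonoOn (fun x => max a x ^ (τ₂ - τ₁)) (Icc a b) := by
    intro x hx y hy hxy
    simp only [hclamp x hx, hclamp y hy]
    exact Real.rpow_lt_rpow (ha0.le.trans hx.1) hxy (sub_pos.2 hτ)
  have key := integral_integral_div_sq_lt_of_strictAntiOn hab (hpow (τ₂ - τ₁)) (hpow (1 - τ₂)) hKc
    (fun x _ => Real.rpow_pos_of_pos (hpos x) _) (fun x _ => Real.rpow_pos_of_pos (hpos x) _)
    hrmono (fun y hy => by simpa only [hsymm _ y] using hright y hy) hright
  have hprod : ∀ x, max a x ^ (τ₂ - τ₁) * max a x ^ (1 - τ₂) = max a x ^ (1 - τ₁) := fun x => by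
    rw [← Real.rpow_add (hpos x)]
    congr 1
    ring
  simp only [hprod] at key
  have hDeq : ∀ τ, D τ = (∫ x in a..b, ∫ y in a..b, K x y * max a x ^ (1 - τ) *
      max a y ^ (1 - τ)) / (∫ x in a..b, max a x ^ (1 - τ)) ^ 2 := by
    intro τ
    rw [hD τ]
    congr 1
    · refine intervalIntegral.integral_congr fun x hx =>
        intervalIntegral.integral_congr fun y hy => ?_
      rw [uIcc_of_le hab.le] at hx hy
      have hx0 := ha0.trans_le hx.1
      have hy0 := ha0.trans_le hy.1
      simp only [hKeq x hx y hy, hclamp x hx, hclamp y hy]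
      rw [mul_assoc, ← Real.mul_rpow hx0.le hy0.le, show 2 - τ = 1 + (1 - τ) by ring,
        Real.rpow_add (mul_pos hx0 hy0), Real.rpow_one]
      ring
    · congr 1
      refine intervalIntegral.integral_congr fun x hx => ?_
      rw [uIcc_of_le hab.le] at hx
      simp only [hclamp x hx]
  rw [hDeq τ₁, hDeq τ₂]
  exact key
end

section
/- Let f : [0,∞) → (0,1] be continuously differentiable with f(0) = 1, f monotone non-increasing (condition F1), u ↦ u·f(u) monotone non-decreasing (condition F2), and u ↦ −u·f'(u)/f(u) monotone non-decreasing on [0,∞) (condition F4). Fix real numbers 0 < a < b and a real exponent τ. Define, for h ≥ 0, c_{a,b}(h) = (∫_a^b ∫_a^b (x·y)^(2−τ) f(a·h·x) f(a·h·y) f(x·y) dx dy) / (∫_a^b x^(1−τ) f(a·h·x) dx)^2. Then c_{a,b} is monotone non-increasing in h on [0,∞). -/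
open MeasureTheory Set

/-- If `v / w` is nonincreasing, the `v`-average of a monotone function is at most its
`w`-average. -/
theorem integral_mul_monotone_le_of_ratio {a b : ℝ} (hab : a ≤ b) {v w g : ℝ → ℝ}
    (hv : ContinuousOn v (Icc a b)) (hw : ContinuousOn w (Icc a b))
    (hg : MonotoneOn g (Icc a b))
    (hr : ∀ x ∈ Icc a b, ∀ y ∈ Icc a b, x ≤ y → v y * w x ≤ w y * v x) :
    (∫ x in a..b, v x * g x) * (∫ x in a..b, w x) ≤
      (∫ x in a..b, w x * g x) * (∫ x in a..b, v x) := by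
  have hgi : IntervalIntegrable g volume a b :=
    MonotoneOn.intervalIntegrable (by rwa [uIcc_of_le hab])
  have hv' : ContinuousOn v (uIcc a b) := by rwa [uIcc_of_le hab]
  have hw' : ContinuousOn w (uIcc a b) := by rwa [uIcc_of_le hab]
  have hvi := hv'.intervalIntegrable (μ := volume)
  have hwi := hw'.intervalIntegrable (μ := volume)
  have hvg : IntervalIntegrable (fun x => v x * g x) volume a b := hgi.continuousOn_mul hv'
  have hwg : IntervalIntegrable (fun x => w x * g x) volume a b := hgi.continuousOn_mul hw'
  set V := ∫ x in a..b, v x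
  set W := ∫ x in a..b, w x
  set Gv := ∫ x in a..b, v x * g x
  set Gw := ∫ x in a..b, w x * g x
  have inner : ∀ x, ∫ y in a..b, (g x - g y) * (w x * v y - v x * w y) =
      V * (w x * g x) - W * (v x * g x) - Gv * w x + Gw * v x := by
    intro x
    have : (fun y => (g x - g y) * (w x * v y - v x * w y)) = fun y =>
        (w x * g x) * v y - (v x * g x) * w y - w x * (v y * g y) + v x * (w y * g y) := by
      funext y; ring
    rw [this, intervalIntegral.integral_add
        (((hvi.const_mul _).sub (hwi.const_mul _)).sub (hvg.const_mul _)) (hwg.const_mul _),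
      intervalIntegral.integral_sub ((hvi.const_mul _).sub (hwi.const_mul _)) (hvg.const_mul _),
      intervalIntegral.integral_sub (hvi.const_mul _) (hwi.const_mul _)]
    simp only [intervalIntegral.integral_const_mul]
    ring
  have outer : ∫ x in a..b, ∫ y in a..b, (g x - g y) * (w x * v y - v x * w y) =
      2 * (Gw * V - Gv * W) := by
    simp only [inner]
    rw [intervalIntegral.integral_add
        (((hwg.const_mul _).sub (hvg.const_mul _)).sub (hwi.const_mul _)) (hvi.const_mul _),
      intervalIntegral.integral_sub ((hwg.const_mul _).sub (hvg.const_mul _)) (hwi.const_mul _),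
      intervalIntegral.integral_sub (hwg.const_mul _) (hvg.const_mul _)]
    simp only [intervalIntegral.integral_const_mul]
    ring
  have nonneg : 0 ≤ ∫ x in a..b, ∫ y in a..b, (g x - g y) * (w x * v y - v x * w y) := by
    refine intervalIntegral.integral_nonneg hab fun x hx =>
      intervalIntegral.integral_nonneg hab fun y hy => ?_
    rcases le_total x y with h | h
    · exact mul_nonneg_of_nonpos_of_nonpos (sub_nonpos.2 (hg hx hy h))
        (by linarith [hr x hx y hy h])
    · exact mul_nonneg (sub_nonneg.2 (hg hy hx h)) (by linarith [hr y hy x hx h])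
  linarith

/-- Two-variable version of `integral_mul_monotone_le_of_ratio`, for a kernel monotone in each
variable. -/
theorem integral_integral_kernel_le_of_ratio {a b : ℝ} (hab : a ≤ b) {v w : ℝ → ℝ}
    {K : ℝ → ℝ → ℝ} (hv : ContinuousOn v (Icc a b)) (hw : ContinuousOn w (Icc a b))
    (hv0 : ∀ x ∈ Icc a b, 0 ≤ v x) (hw0 : ∀ x ∈ Icc a b, 0 ≤ w x)
    (hK₁ : ∀ y ∈ Icc a b, MonotoneOn (fun x => K x y) (Icc a b))
    (hK₂ : ∀ x ∈ Icc a b, MonotoneOn (K x) (Icc a b))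
    (hr : ∀ x ∈ Icc a b, ∀ y ∈ Icc a b, x ≤ y → v y * w x ≤ w y * v x) :
    (∫ x in a..b, v x * ∫ y in a..b, v y * K x y) * (∫ x in a..b, w x) ^ 2 ≤
      (∫ x in a..b, w x * ∫ y in a..b, w y * K x y) * (∫ x in a..b, v x) ^ 2 := by
  have hint : ∀ u : ℝ → ℝ, ContinuousOn u (Icc a b) → ∀ x ∈ Icc a b,
      IntervalIntegrable (fun y => u y * K x y) volume a b := fun u hu x hx =>
    (MonotoneOn.intervalIntegrable (by rw [uIcc_of_le hab]; exact hK₂ x hx)).continuousOn_mul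
      (by rwa [uIcc_of_le hab])
  have hmono : ∀ u : ℝ → ℝ, ContinuousOn u (Icc a b) → (∀ x ∈ Icc a b, 0 ≤ u x) →
      MonotoneOn (fun x => ∫ y in a..b, u y * K x y) (Icc a b) := fun u hu hu0 x hx x' hx' h =>
    intervalIntegral.integral_mono_on hab (hint u hu x hx) (hint u hu x' hx') fun y hy =>
      mul_le_mul_of_nonneg_left (hK₁ y hy hx hx' h) (hu0 y hy)
  have hint' : ∀ u : ℝ → ℝ, ContinuousOn u (Icc a b) → (∀ x ∈ Icc a b, 0 ≤ u x) →
      IntervalIntegrable (fun x => w x * ∫ y in a..b, u y * K x y) volume a b := fun u hu hu0 =>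
    (MonotoneOn.intervalIntegrable
      (by rw [uIcc_of_le hab]; exact hmono u hu hu0)).continuousOn_mul (by rwa [uIcc_of_le hab])
  have outer := integral_mul_monotone_le_of_ratio hab hv hw (hmono v hv hv0) hr
  have inner : (∫ x in a..b, w x * ∫ y in a..b, v y * K x y) * (∫ x in a..b, w x) ≤
      (∫ x in a..b, w x * ∫ y in a..b, w y * K x y) * (∫ x in a..b, v x) := by
    rw [← intervalIntegral.integral_mul_const, ← intervalIntegral.integral_mul_const]
    refine intervalIntegral.integral_mono_on hab ((hint' v hv hv0).mul_const _)
      ((hint' w hw hw0).mul_const _) fun x hx => ?_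
    rw [mul_assoc, mul_assoc]
    exact mul_le_mul_of_nonneg_left
      (integral_mul_monotone_le_of_ratio hab hv hw (hK₂ x hx) hr) (hw0 x hx)
  have hV : 0 ≤ ∫ x in a..b, v x := intervalIntegral.integral_nonneg hab hv0
  have hW : 0 ≤ ∫ x in a..b, w x := intervalIntegral.integral_nonneg hab hw0
  have h₁ := mul_le_mul_of_nonneg_right outer hW
  have h₂ := mul_le_mul_of_nonneg_right inner hV
  linarith

/-- If the logarithmic elasticity `u ↦ -u f'(u) / f(u)` is nondecreasing, then
`t ↦ f (l * t) / f (k * t)` is nonincreasing for `0 ≤ k ≤ l`. -/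
theorem antitoneOn_dilation_ratio {f f' : ℝ → ℝ}
    (hderiv : ∀ v ∈ Ici (0 : ℝ), HasDerivAt f (f' v) v)
    (hfpos : ∀ u ∈ Ici (0 : ℝ), 0 < f u)
    (helast : MonotoneOn (fun u => -u * f' u / f u) (Ici 0))
    {k l : ℝ} (hk : 0 ≤ k) (hkl : k ≤ l) :
    AntitoneOn (fun t => f (l * t) / f (k * t)) (Ici 0) := by
  have hl := hk.trans hkl
  have hd : ∀ t ∈ Ici (0 : ℝ), HasDerivAt (fun t => f (l * t) / f (k * t))
      ((f' (l * t) * l * f (k * t) - f (l * t) * (f' (k * t) * k)) / f (k * t) ^ 2) t := by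
    intro t ht
    have dil : ∀ m : ℝ, 0 ≤ m → HasDerivAt (fun t => f (m * t)) (f' (m * t) * m) t := by
      intro m hm
      have h := (hasDerivAt_id t).const_mul m
      rw [mul_one] at h
      exact HasDerivAt.comp t (hderiv (m * t) (mul_nonneg hm ht)) h
    exact (dil l hl).div (dil k hk) (hfpos _ (mul_nonneg hk ht)).ne'
  refine antitoneOn_of_deriv_nonpos (convex_Ici 0)
    (fun t ht => (hd t ht).continuousAt.continuousWithinAt)
    (fun t ht => (hd t (interior_subset ht)).differentiableAt.differentiableWithinAt) ?_
  intro t ht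
  rw [interior_Ici] at ht
  have ht : 0 < t := ht
  rw [(hd t ht.le).deriv]
  refine div_nonpos_of_nonpos_of_nonneg ?_ (sq_nonneg _)
  have hkt : k * t ∈ Ici (0 : ℝ) := mul_nonneg hk ht.le
  have hlt : l * t ∈ Ici (0 : ℝ) := mul_nonneg hl ht.le
  have h := helast hkt hlt (mul_le_mul_of_nonneg_right hkl ht.le)
  dsimp only at h
  rw [div_le_div_iff₀ (hfpos _ hkt) (hfpos _ hlt)] at h
  refine le_of_mul_le_mul_left ?_ ht
  linarith

open MeasureTheory Set

theorem local_clustering_antitone_in_h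
    (f f' : ℝ → ℝ)
    (hderiv : ∀ v ∈ Ici (0:ℝ), HasDerivAt f (f' v) v)
    (hf'c : ContinuousOn f' (Ici 0))
    (hfpos : ∀ u ∈ Ici (0:ℝ), 0 < f u)
    (hfle : ∀ u ∈ Ici (0:ℝ), f u ≤ 1)
    (hf0 : f 0 = 1)
    (hF1 : AntitoneOn f (Ici 0))
    (hF2 : MonotoneOn (fun u => u * f u) (Ici 0))
    (hF4 : MonotoneOn (fun u => -u * f' u / f u) (Ici 0))
    (a b : ℝ) (ha : 0 < a) (hab : a < b) (τ : ℝ)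
    (c : ℝ → ℝ)
    (hc : ∀ h : ℝ, c h =
      (∫ x in a..b, ∫ y in a..b,
          (x * y) ^ (2 - τ) * f (a * h * x) * f (a * h * y) * f (x * y)) /
        (∫ x in a..b, x ^ (1 - τ) * f (a * h * x)) ^ 2) :
    ∀ h₁ ∈ Ici (0:ℝ), ∀ h₂ ∈ Ici (0:ℝ), h₁ ≤ h₂ → c h₂ ≤ c h₁ := by
  intro h₁ hh₁ h₂ hh₂ h12
  have hpos : ∀ x ∈ Icc a b, 0 < x := fun x hx => ha.trans_le hx.1
  have hmem : ∀ h ∈ Ici (0:ℝ), ∀ x ∈ Icc a b, a * h * x ∈ Ici (0:ℝ) := fun h hh x hx =>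
    mul_nonneg (mul_nonneg ha.le hh) (hpos x hx).le
  have hfc : ContinuousOn f (Ici 0) := fun x hx =>
    (hderiv x hx).continuousAt.continuousWithinAt
  have hwc : ∀ h ∈ Ici (0:ℝ),
      ContinuousOn (fun x => x ^ (1 - τ) * f (a * h * x)) (Icc a b) := fun h hh =>
    (continuousOn_id.rpow_const fun x hx => Or.inl (hpos x hx).ne').mul
      (hfc.comp (by fun_prop) (hmem h hh))
  have hwpos : ∀ h ∈ Ici (0:ℝ), ∀ x ∈ Icc a b, 0 < x ^ (1 - τ) * f (a * h * x) :=
    fun h hh x hx => mul_pos (Real.rpow_pos_of_pos (hpos x hx) _) (hfpos _ (hmem h hh x hx))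
  have hWpos : ∀ h ∈ Ici (0:ℝ), 0 < ∫ x in a..b, x ^ (1 - τ) * f (a * h * x) := fun h hh =>
    intervalIntegral.intervalIntegral_pos_of_pos_on
      (ContinuousOn.intervalIntegrable (by rw [uIcc_of_le hab.le]; exact hwc h hh))
      (fun x hx => hwpos h hh x (Ioo_subset_Icc_self hx)) hab
  have hnum : ∀ h, (∫ x in a..b, ∫ y in a..b,
        (x * y) ^ (2 - τ) * f (a * h * x) * f (a * h * y) * f (x * y)) =
      ∫ x in a..b, (x ^ (1 - τ) * f (a * h * x)) *
        ∫ y in a..b, (y ^ (1 - τ) * f (a * h * y)) * (x * y * f (x * y)) := by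
    intro h
    refine intervalIntegral.integral_congr fun x hx => ?_
    rw [uIcc_of_le hab.le] at hx
    rw [← intervalIntegral.integral_const_mul]
    refine intervalIntegral.integral_congr fun y hy => ?_
    rw [uIcc_of_le hab.le] at hy
    have hx0 := hpos x hx
    have hy0 := hpos y hy
    rw [show 2 - τ = (1 - τ) + 1 by ring, Real.rpow_add_one (mul_pos hx0 hy0).ne',
      Real.mul_rpow hx0.le hy0.le]
    ring
  have hK : ∀ x ∈ Icc a b, MonotoneOn (fun y => x * y * f (x * y)) (Icc a b) :=
    fun x hx y hy y' hy' hyy => hF2 (mul_nonneg (hpos x hx).le (hpos y hy).le)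
      (mul_nonneg (hpos x hx).le (hpos y' hy').le)
      (mul_le_mul_of_nonneg_left hyy (hpos x hx).le)
  rw [hc, hc, hnum, hnum, div_le_div_iff₀ (pow_pos (hWpos h₂ hh₂) 2) (pow_pos (hWpos h₁ hh₁) 2)]
  refine integral_integral_kernel_le_of_ratio (K := fun x y => x * y * f (x * y)) hab.le
    (hwc h₂ hh₂) (hwc h₁ hh₁) (fun x hx => (hwpos h₂ hh₂ x hx).le)
    (fun x hx => (hwpos h₁ hh₁ x hx).le) (fun y hy => ?_) hK fun x hx y hy hxy => ?_
  · simpa only [mul_comm] using hK y hy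
  · have h := antitoneOn_dilation_ratio hderiv hfpos hF4 (mul_nonneg ha.le hh₁)
      (mul_le_mul_of_nonneg_left h12 ha.le) (hpos x hx).le (hpos y hy).le hxy
    dsimp only at h
    rw [div_le_div_iff₀ (hfpos _ (hmem h₁ hh₁ y hy)) (hfpos _ (hmem h₁ hh₁ x hx))] at h
    have h' := mul_le_mul_of_nonneg_left h (mul_pos (Real.rpow_pos_of_pos (hpos x hx) (1 - τ))
      (Real.rpow_pos_of_pos (hpos y hy) (1 - τ))).le
    linarith
end

section
/- Let τ be a real number with 2 < τ < 3, and let a, b be real numbers with 0 < a, b ≥ 1 and a·b ≤ 1. Then (∫_a^b ∫_a^b min(1, 1/(x·y)) · (x·y)^(2−τ) dx dy) / (∫_a^b x^(1−τ) dx)^2 = ((τ−2)^2 / (a^(2−τ) − b^(2−τ))^2) · [ ln(b^2) / ((τ−2)(3−τ)) − (1 − b^(2(2−τ))) / (τ−2)^2 + (1 − 2(a·b)^(3−τ) + a^(2(3−τ))) / (3−τ)^2 ]. -/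
open MeasureTheory Set

theorem integral_eq_add_of_eqOn {f g h : ℝ → ℝ} {a b c : ℝ} (hac : a ≤ c) (hcb : c ≤ b)
    (hfg : EqOn f g (Icc a c)) (hfh : EqOn f h (Icc c b))
    (hg : ContinuousOn g (Icc a c)) (hh : ContinuousOn h (Icc c b)) :
    ∫ x in a..b, f x = (∫ x in a..c, g x) + ∫ x in c..b, h x := by
  have hf₁ : IntervalIntegrable f volume a c :=
    (hg.congr hfg).intervalIntegrable_of_Icc hac
  have hf₂ : IntervalIntegrable f volume c b :=
    (hh.congr hfh).intervalIntegrable_of_Icc hcb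
  rw [← intervalIntegral.integral_add_adjacent_intervals hf₁ hf₂]
  congr 1
  · exact intervalIntegral.integral_congr (by rwa [uIcc_of_le hac])
  · exact intervalIntegral.integral_congr (by rwa [uIcc_of_le hcb])

theorem continuousOn_rpow_Icc {a b : ℝ} (ha : 0 < a) (r : ℝ) :
    ContinuousOn (fun x : ℝ => x ^ r) (Icc a b) := fun _ hx =>
  (Real.continuousAt_rpow_const _ _ (Or.inl (ha.trans_le hx.1).ne')).continuousWithinAt

theorem integral_rpow_of_pos {a b r s : ℝ} (ha : 0 < a) (hab : a ≤ b) (hrs : r + 1 = s)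
    (hs : s ≠ 0) : ∫ x in a..b, x ^ r = (b ^ s - a ^ s) / s := by
  subst hrs
  refine integral_rpow (Or.inr ⟨fun h => hs (by rw [h]; norm_num), ?_⟩)
  rw [uIcc_of_le hab]
  exact fun h => ha.not_ge h.1

theorem min_one_mul_rpow_of_le_one {τ x y : ℝ} (hx : 0 < x) (hy : 0 < y) (h : x * y ≤ 1) :
    min 1 (1 / (x * y)) * (x * y) ^ (2 - τ) = x ^ (2 - τ) * y ^ (2 - τ) := by
  rw [min_eq_left ((one_le_div (mul_pos hx hy)).2 h), one_mul, Real.mul_rpow hx.le hy.le]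

theorem min_one_mul_rpow_of_one_le {τ x y : ℝ} (hx : 0 < x) (hy : 0 < y) (h : 1 ≤ x * y) :
    min 1 (1 / (x * y)) * (x * y) ^ (2 - τ) = x ^ (1 - τ) * y ^ (1 - τ) := by
  have hxy := mul_pos hx hy
  rw [min_eq_right ((div_le_one hxy).2 h), ← Real.mul_rpow hx.le hy.le,
    show 2 - τ = 1 - τ + 1 by ring, Real.rpow_add_one hxy.ne']
  field_simp

theorem integral_min_one_mul_rpow_of_mul_le_one {τ a b x : ℝ} (hτ3 : τ < 3) (ha : 0 < a)
    (hab : a ≤ b) (hx : 0 < x) (hxb : x * b ≤ 1) :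
    ∫ y in a..b, min 1 (1 / (x * y)) * (x * y) ^ (2 - τ) =
      (b ^ (3 - τ) - a ^ (3 - τ)) / (3 - τ) * x ^ (2 - τ) := by
  have hcongr : EqOn (fun y => min 1 (1 / (x * y)) * (x * y) ^ (2 - τ))
      (fun y => x ^ (2 - τ) * y ^ (2 - τ)) (uIcc a b) := by
    rw [uIcc_of_le hab]
    exact fun y hy => min_one_mul_rpow_of_le_one hx (ha.trans_le hy.1)
      ((mul_le_mul_of_nonneg_left hy.2 hx.le).trans hxb)
  rw [intervalIntegral.integral_congr hcongr, intervalIntegral.integral_const_mul,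
    integral_rpow_of_pos ha hab (show 2 - τ + 1 = 3 - τ by ring) (by linarith), mul_comm]

theorem integral_min_one_mul_rpow_of_one_le_mul {τ a b x : ℝ} (hτ2 : 2 < τ) (hτ3 : τ < 3)
    (ha : 0 < a) (hx : 0 < x) (hxa : x * a ≤ 1) (hxb : 1 ≤ x * b) :
    ∫ y in a..b, min 1 (1 / (x * y)) * (x * y) ^ (2 - τ) =
      1 / ((τ - 2) * (3 - τ)) * x⁻¹ - a ^ (3 - τ) / (3 - τ) * x ^ (2 - τ)
        - b ^ (2 - τ) / (τ - 2) * x ^ (1 - τ) := by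
  have hac : a ≤ x⁻¹ := by rw [← one_div, le_div_iff₀' hx]; exact hxa
  have hcb : x⁻¹ ≤ b := by rw [← one_div, div_le_iff₀' hx]; exact hxb
  have hx' : 0 < x⁻¹ := inv_pos.2 hx
  have hp : 3 - τ ≠ 0 := by linarith
  have hq : τ - 2 ≠ 0 := by linarith
  have hq' : 2 - τ ≠ 0 := by linarith
  rw [integral_eq_add_of_eqOn (g := fun y => x ^ (2 - τ) * y ^ (2 - τ))
      (h := fun y => x ^ (1 - τ) * y ^ (1 - τ)) hac hcb
      (fun y hy => min_one_mul_rpow_of_le_one hx (ha.trans_le hy.1)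
        (by simpa [hx.ne'] using mul_le_mul_of_nonneg_left hy.2 hx.le))
      (fun y hy => min_one_mul_rpow_of_one_le hx (hx'.trans_le hy.1)
        (by simpa [hx.ne'] using mul_le_mul_of_nonneg_left hy.1 hx.le))
      (continuousOn_const.mul (continuousOn_rpow_Icc ha _))
      (continuousOn_const.mul (continuousOn_rpow_Icc hx' _)),
    intervalIntegral.integral_const_mul, intervalIntegral.integral_const_mul,
    integral_rpow_of_pos ha hac (show 2 - τ + 1 = 3 - τ by ring) hp,
    integral_rpow_of_pos hx' hcb (show 1 - τ + 1 = 2 - τ by ring) hq']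
  have h₁ : x ^ (2 - τ) * x⁻¹ ^ (3 - τ) = x⁻¹ := by
    rw [Real.inv_rpow hx.le, ← Real.rpow_neg hx.le, ← Real.rpow_add hx, ← Real.rpow_neg_one]
    ring_nf
  have h₂ : x ^ (1 - τ) * x⁻¹ ^ (2 - τ) = x⁻¹ := by
    rw [Real.inv_rpow hx.le, ← Real.rpow_neg hx.le, ← Real.rpow_add hx, ← Real.rpow_neg_one]
    ring_nf
  have hsum : 1 / ((τ - 2) * (3 - τ)) = 1 / (3 - τ) + 1 / (τ - 2) := by field_simp; ring
  have hneg : (2 - τ)⁻¹ = -(τ - 2)⁻¹ := by rw [← inv_neg, neg_sub]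
  rw [hsum]
  simp only [div_eq_mul_inv, hneg]
  linear_combination (3 - τ)⁻¹ * h₁ + (τ - 2)⁻¹ * h₂

theorem integral_integral_min_one_mul_rpow {τ a b : ℝ} (hτ2 : 2 < τ) (hτ3 : τ < 3)
    (ha : 0 < a) (hb : 1 ≤ b) (hab : a * b ≤ 1) :
    ∫ x in a..b, ∫ y in a..b, min 1 (1 / (x * y)) * (x * y) ^ (2 - τ) =
      Real.log (b ^ 2) / ((τ - 2) * (3 - τ))
        - (1 - b ^ (2 * (2 - τ))) / (τ - 2) ^ 2
        + (1 - 2 * (a * b) ^ (3 - τ) + a ^ (2 * (3 - τ))) / (3 - τ) ^ 2 := by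
  have hb0 : 0 < b := one_pos.trans_le hb
  have hb' : 0 < b⁻¹ := inv_pos.2 hb0
  have hac : a ≤ b⁻¹ := by rwa [← one_div, le_div_iff₀ hb0]
  have hcb : b⁻¹ ≤ b := (inv_le_one_of_one_le₀ hb).trans hb
  have hp : 3 - τ ≠ 0 := by linarith
  have hq : τ - 2 ≠ 0 := by linarith
  have hq' : 2 - τ ≠ 0 := by linarith
  have hinv : ContinuousOn (fun x : ℝ => 1 / ((τ - 2) * (3 - τ)) * x⁻¹) (Icc b⁻¹ b) :=
    continuousOn_const.mul (continuousOn_id.inv₀ fun x hx => (hb'.trans_le hx.1).ne')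
  have hpow (k r : ℝ) : ContinuousOn (fun x : ℝ => k * x ^ r) (Icc b⁻¹ b) :=
    continuousOn_const.mul (continuousOn_rpow_Icc hb' r)
  have hsub (k l : ℝ) :
      ContinuousOn (fun x : ℝ => 1 / ((τ - 2) * (3 - τ)) * x⁻¹ - k * x ^ l) (Icc b⁻¹ b) :=
    hinv.sub (hpow k l)
  have hle {x : ℝ} (hx : x ∈ Icc b⁻¹ b) : x * a ≤ 1 := by
    rw [mul_comm]
    exact (mul_le_mul_of_nonneg_left hx.2 ha.le).trans hab
  rw [integral_eq_add_of_eqOn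
      (g := fun x => (b ^ (3 - τ) - a ^ (3 - τ)) / (3 - τ) * x ^ (2 - τ))
      (h := fun x => 1 / ((τ - 2) * (3 - τ)) * x⁻¹ - a ^ (3 - τ) / (3 - τ) * x ^ (2 - τ)
        - b ^ (2 - τ) / (τ - 2) * x ^ (1 - τ)) hac hcb
      (fun x hx => integral_min_one_mul_rpow_of_mul_le_one hτ3 ha (hac.trans hcb)
        (ha.trans_le hx.1)
        (by simpa [hb0.ne'] using mul_le_mul_of_nonneg_right hx.2 hb0.le))
      (fun x hx => integral_min_one_mul_rpow_of_one_le_mul hτ2 hτ3 ha (hb'.trans_le hx.1)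
        (hle hx) (by simpa [hb0.ne'] using mul_le_mul_of_nonneg_right hx.1 hb0.le))
      (continuousOn_const.mul (continuousOn_rpow_Icc ha _))
      ((hsub _ _).sub (hpow _ _)),
    intervalIntegral.integral_sub
      ((hsub _ _).intervalIntegrable_of_Icc hcb)
      ((hpow _ _).intervalIntegrable_of_Icc hcb),
    intervalIntegral.integral_sub (hinv.intervalIntegrable_of_Icc hcb)
      ((hpow _ _).intervalIntegrable_of_Icc hcb)]
  simp only [intervalIntegral.integral_const_mul]
  rw [integral_inv_of_pos hb' hb0,
    integral_rpow_of_pos ha hac (show 2 - τ + 1 = 3 - τ by ring) hp,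
    integral_rpow_of_pos hb' hcb (show 2 - τ + 1 = 3 - τ by ring) hp,
    integral_rpow_of_pos hb' hcb (show 1 - τ + 1 = 2 - τ by ring) hq',
    Real.inv_rpow hb0.le, Real.inv_rpow hb0.le, div_inv_eq_mul, ← sq,
    Real.mul_rpow ha.le hb0.le, two_mul (2 - τ), two_mul (3 - τ),
    Real.rpow_add hb0, Real.rpow_add ha]
  have hB : b ^ (3 - τ) ≠ 0 := (Real.rpow_pos_of_pos hb0 _).ne'
  have hC : b ^ (2 - τ) ≠ 0 := (Real.rpow_pos_of_pos hb0 _).ne'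
  generalize b ^ (3 - τ) = B at *
  generalize b ^ (2 - τ) = C at *
  generalize a ^ (3 - τ) = A
  rw [show 2 - τ = -(τ - 2) by ring]
  generalize τ - 2 = q at *
  generalize 3 - τ = p at *
  field_simp
  ring

theorem clustering_max_exact_formula
    (τ a b : ℝ) (hτ2 : 2 < τ) (hτ3 : τ < 3)
    (ha : 0 < a) (hb : 1 ≤ b) (hab : a * b ≤ 1) :
    (∫ x in a..b, ∫ y in a..b, min 1 (1 / (x * y)) * (x * y) ^ (2 - τ)) /
        (∫ x in a..b, x ^ (1 - τ)) ^ 2 =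
      ((τ - 2) ^ 2 / (a ^ (2 - τ) - b ^ (2 - τ)) ^ 2) *
        (Real.log (b ^ 2) / ((τ - 2) * (3 - τ))
          - (1 - b ^ (2 * (2 - τ))) / (τ - 2) ^ 2
          + (1 - 2 * (a * b) ^ (3 - τ) + a ^ (2 * (3 - τ))) / (3 - τ) ^ 2) := by
  have hle : a ≤ b := (le_mul_of_one_le_right ha.le hb).trans (hab.trans hb)
  rw [integral_integral_min_one_mul_rpow hτ2 hτ3 ha hb hab,
    integral_rpow_of_pos ha hle (show 1 - τ + 1 = 2 - τ by ring) (by linarith), div_pow,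
    sub_sq_comm (b ^ (2 - τ)), sub_sq_comm 2 τ, div_div_eq_mul_div]
  ring
end

section
/- Let f : [0,∞) → (0,1] be monotone non-increasing with f(0) = 1, and suppose u ↦ u·f(u) is monotone non-decreasing on [0,∞). Let τ be real with 2 < τ < 3, let 0 < a < b, let u₀ ≥ 1, and set a₀ = a/√u₀ and b₀ = b/√u₀. Then (∫_a^b ∫_a^b f(x·y) (x·y)^(2−τ) dx dy) / (∫_a^b x^(1−τ) dx)^2 ≥ u₀·f(u₀) · (∫_{a₀}^{b₀} ∫_{a₀}^{b₀} min(1, 1/(x·y)) (x·y)^(2−τ) dx dy) / (∫_{a₀}^{b₀} x^(1−τ) dx)^2. -/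
open MeasureTheory Set

/-- The interval integral of an antitone function of a product is antitone in the parameter. -/
lemma antitoneOn_integral_comp_mul {g : ℝ → ℝ} (hg : AntitoneOn g (Ioi 0)) {a b : ℝ}
    (ha : 0 < a) (hab : a ≤ b) :
    (∀ x, 0 < x → IntervalIntegrable (fun y => g (x * y)) volume a b) ∧
      AntitoneOn (fun x => ∫ y in a..b, g (x * y)) (Ioi 0) := by
  have hint : ∀ x, 0 < x → IntervalIntegrable (fun y => g (x * y)) volume a b := by
    intro x hx
    apply AntitoneOn.intervalIntegrable
    rw [uIcc_of_le hab]
    intro y hy z hz hyz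
    exact hg (mul_pos hx (ha.trans_le hy.1)) (mul_pos hx (ha.trans_le hz.1))
      (mul_le_mul_of_nonneg_left hyz hx.le)
  refine ⟨hint, fun x hx x' hx' hxx' => ?_⟩
  refine intervalIntegral.integral_mono_on hab (hint x' hx') (hint x hx) fun y hy => ?_
  have hy0 : 0 < y := ha.trans_le hy.1
  exact hg (mul_pos hx hy0) (mul_pos hx' hy0) (mul_le_mul_of_nonneg_right hxx' hy0.le)

/-- Monotonicity of the double integral of an antitone function of a product. -/
lemma integral_integral_comp_mul_mono {g h : ℝ → ℝ} (hg : AntitoneOn g (Ioi 0))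
    (hh : AntitoneOn h (Ioi 0)) (hgh : ∀ v, 0 < v → g v ≤ h v) {a b : ℝ}
    (ha : 0 < a) (hab : a ≤ b) :
    ∫ x in a..b, ∫ y in a..b, g (x * y) ≤ ∫ x in a..b, ∫ y in a..b, h (x * y) := by
  obtain ⟨hgi, hga⟩ := antitoneOn_integral_comp_mul hg ha hab
  obtain ⟨hhi, hha⟩ := antitoneOn_integral_comp_mul hh ha hab
  have hsub : uIcc a b ⊆ Ioi 0 := by
    rw [uIcc_of_le hab]
    exact fun x hx => ha.trans_le hx.1
  refine intervalIntegral.integral_mono_on hab (hga.mono hsub).intervalIntegrable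
    (hha.mono hsub).intervalIntegrable fun x hx => ?_
  have hx0 : 0 < x := ha.trans_le hx.1
  exact intervalIntegral.integral_mono_on hab (hgi x hx0) (hhi x hx0) fun y hy =>
    hgh _ (mul_pos hx0 (ha.trans_le hy.1))

/-- Scaling both variables of a double integral of a function of the product. -/
lemma integral_integral_comp_mul_scale (g : ℝ → ℝ) (s a b : ℝ) :
    ∫ x in s * a..s * b, ∫ y in s * a..s * b, g (x * y) =
      s ^ 2 * ∫ x in a..b, ∫ y in a..b, g (s ^ 2 * (x * y)) := by
  simp_rw [← intervalIntegral.smul_integral_comp_mul_left (a := a) (b := b) _ s, smul_eq_mul,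
    intervalIntegral.integral_const_mul]
  rw [← mul_assoc, ← sq]
  congr! 6
  ring

/-- The product of a nonnegative antitone function with a nonpositive power is antitone. -/
lemma antitoneOn_mul_rpow {g : ℝ → ℝ} (hg : AntitoneOn g (Ioi 0)) (hg0 : ∀ v, 0 < v → 0 ≤ g v)
    {p : ℝ} (hp : p ≤ 0) : AntitoneOn (fun v => g v * v ^ p) (Ioi 0) := by
  intro v hv w hw hvw
  exact mul_le_mul (hg hv hw hvw) (Real.rpow_le_rpow_of_nonpos hv hvw hp)
    (Real.rpow_nonneg (le_of_lt hw) _) (hg0 v hv)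

/-- A function in the F-class dominates the rescaled maximally dense model. -/
lemma mul_min_one_div_le {f : ℝ → ℝ} (hfpos : ∀ u ∈ Ici (0 : ℝ), 0 < f u)
    (hF1 : AntitoneOn f (Ici 0)) (hF2 : MonotoneOn (fun u => u * f u) (Ici 0))
    {u v : ℝ} (hu : 0 < u) (hv : 0 < v) : f u * min 1 (1 / v) ≤ f (u * v) := by
  have huv : 0 < u * v := mul_pos hu hv
  rcases le_total v 1 with h | h
  · calc f u * min 1 (1 / v) ≤ f u * 1 :=
          mul_le_mul_of_nonneg_left (min_le_left _ _) (hfpos u hu.le).le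
      _ = f u := mul_one _
      _ ≤ f (u * v) := hF1 huv.le hu.le (mul_le_of_le_one_right hu.le h)
  · have h2 : u * f u ≤ u * v * f (u * v) := hF2 hu.le huv.le (le_mul_of_one_le_right hu.le h)
    rw [mul_assoc] at h2
    calc f u * min 1 (1 / v) ≤ f u * (1 / v) :=
          mul_le_mul_of_nonneg_left (min_le_right _ _) (hfpos u hu.le).le
      _ = f u / v := mul_one_div _ _
      _ ≤ f (u * v) := (div_le_iff₀' hv).2 (le_of_mul_le_mul_left h2 hu)

theorem clustering_lower_bound_rescaled_max
    (f : ℝ → ℝ)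
    (hfpos : ∀ u ∈ Ici (0:ℝ), 0 < f u)
    (hfle : ∀ u ∈ Ici (0:ℝ), f u ≤ 1)
    (hf0 : f 0 = 1)
    (hF1 : AntitoneOn f (Ici 0))
    (hF2 : MonotoneOn (fun u => u * f u) (Ici 0))
    (τ a b u₀ : ℝ) (hτ2 : 2 < τ) (hτ3 : τ < 3)
    (ha : 0 < a) (hab : a < b) (hu₀ : 1 ≤ u₀)
    (a₀ b₀ : ℝ) (ha₀ : a₀ = a / Real.sqrt u₀) (hb₀ : b₀ = b / Real.sqrt u₀) :
    (∫ x in a..b, ∫ y in a..b, f (x * y) * (x * y) ^ (2 - τ)) /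
        (∫ x in a..b, x ^ (1 - τ)) ^ 2 ≥
      u₀ * f u₀ *
        ((∫ x in a₀..b₀, ∫ y in a₀..b₀, min 1 (1 / (x * y)) * (x * y) ^ (2 - τ)) /
          (∫ x in a₀..b₀, x ^ (1 - τ)) ^ 2) := by
  have hu : 0 < u₀ := one_pos.trans_le hu₀
  obtain ⟨s, hs⟩ : ∃ s, s = Real.sqrt u₀ := ⟨_, rfl⟩
  have hs0 : 0 < s := hs ▸ Real.sqrt_pos.2 hu
  have hs2 : s ^ 2 = u₀ := hs ▸ Real.sq_sqrt hu.le
  rw [← hs] at ha₀ hb₀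
  have ha' : a = s * a₀ := by rw [ha₀]; field_simp
  have hb' : b = s * b₀ := by rw [hb₀]; field_simp
  have ha₀0 : 0 < a₀ := ha₀ ▸ div_pos ha hs0
  have hab₀ : a₀ < b₀ := by rw [ha₀, hb₀]; exact div_lt_div_of_pos_right hab hs0
  have hden : ∫ x in a..b, x ^ (1 - τ) = s ^ (2 - τ) * ∫ x in a₀..b₀, x ^ (1 - τ) := by
    rw [ha', hb', ← intervalIntegral.smul_integral_comp_mul_left, smul_eq_mul,
      ← intervalIntegral.integral_const_mul, ← intervalIntegral.integral_const_mul]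
    refine intervalIntegral.integral_congr fun x hx => ?_
    rw [uIcc_of_le hab₀.le] at hx
    have hx0 : 0 < x := ha₀0.trans_le hx.1
    rw [Real.mul_rpow hs0.le hx0.le, ← mul_assoc, show 2 - τ = 1 + (1 - τ) by ring,
      Real.rpow_add hs0, Real.rpow_one]
  have hpow : (s ^ (2 - τ)) ^ 2 = u₀ ^ (2 - τ) := by
    rw [← hs2, ← Real.rpow_natCast_mul hs0.le, ← Real.rpow_mul_natCast hs0.le, mul_comm]
  have hp0 : 0 < u₀ ^ (2 - τ) := Real.rpow_pos_of_pos hu _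
  have hmin : AntitoneOn (fun v : ℝ => min 1 (1 / v)) (Ioi 0) := fun v hv w _ hvw =>
    min_le_min_left _ (one_div_le_one_div_of_le hv hvw)
  have hmax := antitoneOn_mul_rpow hmin
    (fun v hv => le_min zero_le_one (one_div_pos.2 hv).le) (sub_nonpos.2 hτ2.le)
  have hf := antitoneOn_mul_rpow (hF1.mono Ioi_subset_Ici_self)
    (fun v hv => (hfpos v (le_of_lt hv)).le) (sub_nonpos.2 hτ2.le)
  have hnum : u₀ ^ (2 - τ) * f u₀ *
      (∫ x in a₀..b₀, ∫ y in a₀..b₀, min 1 (1 / (x * y)) * (x * y) ^ (2 - τ)) ≤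
      ∫ x in a₀..b₀, ∫ y in a₀..b₀, f (u₀ * (x * y)) * (u₀ * (x * y)) ^ (2 - τ) := by
    simp_rw [← intervalIntegral.integral_const_mul]
    refine integral_integral_comp_mul_mono
      (g := fun v => u₀ ^ (2 - τ) * f u₀ * (min 1 (1 / v) * v ^ (2 - τ)))
      (h := fun v => f (u₀ * v) * (u₀ * v) ^ (2 - τ)) ?_ ?_ ?_ ha₀0 hab₀.le
    · exact fun v hv w hw hvw => mul_le_mul_of_nonneg_left (hmax hv hw hvw)
        (mul_pos hp0 (hfpos u₀ hu.le)).le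
    · exact fun v hv w hw hvw => hf (mul_pos hu hv) (mul_pos hu hw)
        (mul_le_mul_of_nonneg_left hvw hu.le)
    · intro v hv
      have key := mul_min_one_div_le hfpos hF1 hF2 hu hv
      rw [Real.mul_rpow hu.le hv.le]
      calc _ = f u₀ * min 1 (1 / v) * (u₀ ^ (2 - τ) * v ^ (2 - τ)) := by ring
        _ ≤ _ := mul_le_mul_of_nonneg_right key
          (mul_pos hp0 (Real.rpow_pos_of_pos hv _)).le
  have hscale := integral_integral_comp_mul_scale (fun v => f v * v ^ (2 - τ)) s a₀ b₀
  simp only [← ha', ← hb', hs2] at hscale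
  rw [hscale, hden, mul_pow, hpow, ge_iff_le]
  set D := ∫ x in a₀..b₀, x ^ (1 - τ)
  calc _ = u₀ * (u₀ ^ (2 - τ) * f u₀ *
        (∫ x in a₀..b₀, ∫ y in a₀..b₀, min 1 (1 / (x * y)) * (x * y) ^ (2 - τ))) /
          (u₀ ^ (2 - τ) * D ^ 2) := by
        rw [show ∀ A B C : ℝ, u₀ * (A * B * C) = A * (u₀ * B * C) by intros; ring,
          mul_div_mul_left _ _ hp0.ne', mul_div_assoc]
    _ ≤ _ := div_le_div_of_nonneg_right (mul_le_mul_of_nonneg_left hnum hu.le)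
        (mul_nonneg hp0.le (sq_nonneg D))
end

section
/- Let 0 < l < M be real numbers and define, for real τ, A(τ) = (∫_l^M h^(−τ)·(1 − (1+h)e^(−h)) dh) / (∫_l^M h^(−τ) dh). Then A is monotone non-increasing in τ: for all real τ₁ ≤ τ₂, A(τ₂) ≤ A(τ₁). -/
open MeasureTheory Set

/-- Chebyshev's integral inequality for two weights `u`, `v` with `v / u` decreasing. -/
theorem integral_mul_mul_integral_le_of_monotoneOn {a b : ℝ} (hab : a ≤ b) {f u v : ℝ → ℝ}
    (hf : ContinuousOn f (Icc a b)) (hu : ContinuousOn u (Icc a b))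
    (hv : ContinuousOn v (Icc a b)) (hmono : MonotoneOn f (Icc a b))
    (huv : ∀ x ∈ Icc a b, ∀ y ∈ Icc a b, x ≤ y → v y * u x ≤ u y * v x) :
    (∫ x in a..b, v x * f x) * (∫ x in a..b, u x) ≤
      (∫ x in a..b, u x * f x) * (∫ x in a..b, v x) := by
  have iu := hu.intervalIntegrable_of_Icc (μ := volume) hab
  have iv := hv.intervalIntegrable_of_Icc (μ := volume) hab
  have iuf : IntervalIntegrable (fun x => u x * f x) volume a b :=
    (hu.mul hf).intervalIntegrable_of_Icc hab
  have ivf : IntervalIntegrable (fun x => v x * f x) volume a b :=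
    (hv.mul hf).intervalIntegrable_of_Icc hab
  have expand : ∀ p q r s : ℝ,
      ∫ y in a..b, (p * u y + q * v y + r * (u y * f y) + s * (v y * f y)) =
        p * (∫ y in a..b, u y) + q * (∫ y in a..b, v y) +
          r * (∫ y in a..b, u y * f y) + s * (∫ y in a..b, v y * f y) := by
    intro p q r s
    rw [intervalIntegral.integral_add (((iu.const_mul p).add (iv.const_mul q)).add
        (iuf.const_mul r)) (ivf.const_mul s),
      intervalIntegral.integral_add ((iu.const_mul p).add (iv.const_mul q)) (iuf.const_mul r),
      intervalIntegral.integral_add (iu.const_mul p) (iv.const_mul q)]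
    simp only [intervalIntegral.integral_const_mul]
  have kernel_nonneg : ∀ x ∈ Icc a b, ∀ y ∈ Icc a b,
      0 ≤ (f x - f y) * (u x * v y - v x * u y) := by
    intro x hx y hy
    rcases le_total x y with h | h
    · have h₁ := hmono hx hy h
      have h₂ := huv x hx y hy h
      exact mul_nonneg_of_nonpos_of_nonpos (by linarith) (by linarith)
    · have h₁ := hmono hy hx h
      have h₂ := huv y hy x hx h
      exact mul_nonneg (by linarith) (by linarith)
  have inner_nonneg : ∀ x ∈ Icc a b,
      0 ≤ (∫ y in a..b, v y * f y) * (-1) * u x + (∫ y in a..b, u y * f y) * v x +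
        (∫ y in a..b, v y) * (u x * f x) + (-(∫ y in a..b, u y)) * (v x * f x) := by
    intro x hx
    have h : 0 ≤ ∫ y in a..b, (-(v x * f x) * u y + u x * f x * v y +
        v x * (u y * f y) + -u x * (v y * f y)) :=
      intervalIntegral.integral_nonneg hab fun y hy =>
        (kernel_nonneg x hx y hy).trans_eq (by ring)
    rw [expand] at h
    linarith
  have h := intervalIntegral.integral_nonneg (μ := volume) hab inner_nonneg
  rw [expand] at h
  linarith

theorem monotoneOn_one_sub_one_add_mul_exp_neg :
    MonotoneOn (fun h : ℝ => 1 - (1 + h) * Real.exp (-h)) (Ici 0) := by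
  intro x hx y _ hxy
  have hx : 0 ≤ x := hx
  have h₁ : 1 + y ≤ (1 + x) * Real.exp (y - x) := by
    nlinarith [Real.add_one_le_exp (y - x), mul_nonneg hx (sub_nonneg.2 hxy)]
  have h₂ := mul_le_mul_of_nonneg_right h₁ (Real.exp_pos (-y)).le
  rw [mul_assoc, ← Real.exp_add, show y - x + -y = -x by ring] at h₂
  exact sub_le_sub_left h₂ 1

theorem rpow_mul_rpow_le_rpow_mul_rpow {x y s t : ℝ} (hx : 0 < x) (hxy : x ≤ y) (hst : s ≤ t) :
    y ^ s * x ^ t ≤ y ^ t * x ^ s := by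
  have hy : 0 < y := hx.trans_le hxy
  have h := Real.rpow_le_rpow hx.le hxy (sub_nonneg.2 hst)
  rw [← sub_add_cancel t s, Real.rpow_add hx, Real.rpow_add hy]
  calc y ^ s * (x ^ (t - s) * x ^ s) = x ^ (t - s) * (y ^ s * x ^ s) := by ring
    _ ≤ y ^ (t - s) * (y ^ s * x ^ s) := by gcongr
    _ = y ^ (t - s) * y ^ s * x ^ s := by ring

theorem A_antitone_in_tau
    (l M : ℝ) (hl : 0 < l) (hlM : l < M)
    (A : ℝ → ℝ)
    (hA : ∀ τ : ℝ, A τ =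
      (∫ h in l..M, h ^ (-τ) * (1 - (1 + h) * Real.exp (-h))) /
        (∫ h in l..M, h ^ (-τ))) :
    ∀ τ₁ τ₂ : ℝ, τ₁ ≤ τ₂ → A τ₂ ≤ A τ₁ := by
  intro τ₁ τ₂ hτ
  have pos : ∀ x ∈ Icc l M, 0 < x := fun x hx => hl.trans_le hx.1
  have cont : ∀ τ : ℝ, ContinuousOn (fun h : ℝ => h ^ (-τ)) (Icc l M) := fun τ =>
    continuousOn_id.rpow_const fun x hx => Or.inl (pos x hx).ne'
  have integral_pos : ∀ τ : ℝ, 0 < ∫ h in l..M, h ^ (-τ) := fun τ =>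
    intervalIntegral.intervalIntegral_pos_of_pos_on
      ((cont τ).intervalIntegrable_of_Icc hlM.le)
      (fun x hx => Real.rpow_pos_of_pos (hl.trans hx.1) _) hlM
  rw [hA, hA, div_le_div_iff₀ (integral_pos τ₂) (integral_pos τ₁)]
  exact integral_mul_mul_integral_le_of_monotoneOn hlM.le (by fun_prop) (cont τ₁) (cont τ₂)
    (monotoneOn_one_sub_one_add_mul_exp_neg.mono fun x hx => (pos x hx).le)
    fun x hx y _ hxy => rpow_mul_rpow_le_rpow_mul_rpow (pos x hx) hxy (neg_le_neg hτ)
end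

section
/- Let f : (0,∞) → (0,∞) be continuous with u ↦ u·f(u) monotone non-decreasing. Fix a real exponent τ and a real number a > 0. Define, for b > a, G(b) = (∫_a^b ∫_a^b (x·y)^(2−τ) f(x·y) dx dy) / (∫_a^b x^(1−τ) dx)^2. Then G is monotone non-decreasing in b on (a,∞): for all a < b₁ ≤ b₂, G(b₁) ≤ G(b₂). -/
open MeasureTheory Set

theorem intervalIntegrable_mul_of_continuousOn_of_monotoneOn {w φ : ℝ → ℝ} {a b c d : ℝ}
    (hac : a ≤ c) (hcd : c ≤ d) (hdb : d ≤ b)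
    (hw : ContinuousOn w (Icc a b)) (hφ : MonotoneOn φ (Icc a b)) :
    IntervalIntegrable (fun x => w x * φ x) volume c d := by
  have hsub : uIcc c d ⊆ Icc a b := by
    rw [uIcc_of_le hcd]
    exact Icc_subset_Icc hac hdb
  exact (hφ.mono hsub).intervalIntegrable.continuousOn_mul (hw.mono hsub)

/-- The weighted average of a monotone function over `[a, b]` is monotone in `b`
(in cross-multiplied form). -/
theorem integral_mul_integral_le_of_monotoneOn {w φ : ℝ → ℝ} {a b c : ℝ}
    (hab : a ≤ b) (hbc : b ≤ c) (hw : ContinuousOn w (Icc a c))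
    (hw0 : ∀ x ∈ Icc a c, 0 ≤ w x) (hφ : MonotoneOn φ (Icc a c)) :
    (∫ x in a..b, w x * φ x) * (∫ x in a..c, w x) ≤
      (∫ x in a..c, w x * φ x) * (∫ x in a..b, w x) := by
  have hb : b ∈ Icc a c := ⟨hab, hbc⟩
  have i1 := intervalIntegrable_mul_of_continuousOn_of_monotoneOn le_rfl hab hbc hw hφ
  have i2 := intervalIntegrable_mul_of_continuousOn_of_monotoneOn hab hbc le_rfl hw hφ
  have j1 : IntervalIntegrable w volume a b :=
    (hw.mono (Icc_subset_Icc le_rfl hbc)).intervalIntegrable_of_Icc hab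
  have j2 : IntervalIntegrable w volume b c :=
    (hw.mono (Icc_subset_Icc hab le_rfl)).intervalIntegrable_of_Icc hbc
  rw [← intervalIntegral.integral_add_adjacent_intervals i1 i2,
    ← intervalIntegral.integral_add_adjacent_intervals j1 j2]
  have h1 : (∫ x in a..b, w x * φ x) ≤ (∫ x in a..b, w x) * φ b := by
    rw [← intervalIntegral.integral_mul_const]
    refine intervalIntegral.integral_mono_on hab i1 (j1.mul_const _) fun x hx => ?_
    have hx' : x ∈ Icc a c := ⟨hx.1, hx.2.trans hbc⟩
    exact mul_le_mul_of_nonneg_left (hφ hx' hb hx.2) (hw0 x hx')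
  have h2 : (∫ x in b..c, w x) * φ b ≤ ∫ x in b..c, w x * φ x := by
    rw [← intervalIntegral.integral_mul_const]
    refine intervalIntegral.integral_mono_on hbc (j2.mul_const _) i2 fun x hx => ?_
    have hx' : x ∈ Icc a c := ⟨hab.trans hx.1, hx.2⟩
    exact mul_le_mul_of_nonneg_left (hφ hb hx' hx.1) (hw0 x hx')
  have m1 : 0 ≤ ∫ x in a..b, w x :=
    intervalIntegral.integral_nonneg hab fun x hx => hw0 x ⟨hx.1, hx.2.trans hbc⟩
  have m2 : 0 ≤ ∫ x in b..c, w x :=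
    intervalIntegral.integral_nonneg hbc fun x hx => hw0 x ⟨hab.trans hx.1, hx.2⟩
  linarith [mul_le_mul_of_nonneg_right h1 m2, mul_le_mul_of_nonneg_right h2 m1]

/-- The average of `g (x * y)` over `[a, b] ×ˢ [a, b]` with respect to the product weight
`w x * w y` is monotone in `b` if `g` is monotone (in cross-multiplied form). -/
theorem integral_integral_mul_sq_le_of_monotoneOn {w g : ℝ → ℝ} {a b c : ℝ}
    (ha : 0 < a) (hab : a ≤ b) (hbc : b ≤ c) (hw : ContinuousOn w (Icc a c))
    (hw0 : ∀ x ∈ Icc a c, 0 ≤ w x) (hg : MonotoneOn g (Ioi 0)) :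
    (∫ x in a..b, w x * ∫ y in a..b, w y * g (x * y)) * (∫ x in a..c, w x) ^ 2 ≤
      (∫ x in a..c, w x * ∫ y in a..c, w y * g (x * y)) * (∫ x in a..b, w x) ^ 2 := by
  have hac := hab.trans hbc
  have hsec : ∀ x ∈ Icc a c, MonotoneOn (fun y => g (x * y)) (Icc a c) := by
    intro x hx y hy z hz hyz
    have hx0 : 0 < x := ha.trans_le hx.1
    exact hg (mul_pos hx0 (ha.trans_le hy.1)) (mul_pos hx0 (ha.trans_le hz.1))
      (mul_le_mul_of_nonneg_left hyz hx0.le)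
  have hint : ∀ d, a ≤ d → d ≤ c →
      MonotoneOn (fun x => ∫ y in a..d, w y * g (x * y)) (Icc a c) := by
    intro d had hdc x hx z hz hxz
    refine intervalIntegral.integral_mono_on had
      (intervalIntegrable_mul_of_continuousOn_of_monotoneOn le_rfl had hdc hw (hsec x hx))
      (intervalIntegrable_mul_of_continuousOn_of_monotoneOn le_rfl had hdc hw (hsec z hz))
      fun y hy => ?_
    have hy0 : 0 < y := ha.trans_le hy.1
    exact mul_le_mul_of_nonneg_left
      (hg (mul_pos (ha.trans_le hx.1) hy0) (mul_pos (ha.trans_le hz.1) hy0)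
        (mul_le_mul_of_nonneg_right hxz hy0.le)) (hw0 y ⟨hy.1, hy.2.trans hdc⟩)
  have inner_le : (∫ x in a..b, w x * ∫ y in a..b, w y * g (x * y)) * (∫ x in a..c, w x) ≤
      (∫ x in a..b, w x * ∫ y in a..c, w y * g (x * y)) * (∫ x in a..b, w x) := by
    rw [← intervalIntegral.integral_mul_const, ← intervalIntegral.integral_mul_const]
    refine intervalIntegral.integral_mono_on hab
      ((intervalIntegrable_mul_of_continuousOn_of_monotoneOn le_rfl hab hbc hw
        (hint b hab hbc)).mul_const _)
      ((intervalIntegrable_mul_of_continuousOn_of_monotoneOn le_rfl hab hbc hw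
        (hint c hac le_rfl)).mul_const _) fun x hx => ?_
    have hx' : x ∈ Icc a c := ⟨hx.1, hx.2.trans hbc⟩
    rw [mul_assoc, mul_assoc]
    exact mul_le_mul_of_nonneg_left
      (integral_mul_integral_le_of_monotoneOn hab hbc hw hw0 (hsec x hx')) (hw0 x hx')
  have outer_le := integral_mul_integral_le_of_monotoneOn hab hbc hw hw0 (hint c hac le_rfl)
  have mb : 0 ≤ ∫ x in a..b, w x :=
    intervalIntegral.integral_nonneg hab fun x hx => hw0 x ⟨hx.1, hx.2.trans hbc⟩
  have mc : 0 ≤ ∫ x in a..c, w x := intervalIntegral.integral_nonneg hac hw0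
  linarith [mul_le_mul_of_nonneg_right inner_le mc, mul_le_mul_of_nonneg_right outer_le mb]

theorem G_monotone_in_b
    (f : ℝ → ℝ)
    (hfc : ContinuousOn f (Ioi 0))
    (hfpos : ∀ u ∈ Ioi (0:ℝ), 0 < f u)
    (hF2 : MonotoneOn (fun u => u * f u) (Ioi 0))
    (τ a : ℝ) (ha : 0 < a)
    (G : ℝ → ℝ)
    (hG : ∀ b : ℝ, G b =
      (∫ x in a..b, ∫ y in a..b, (x * y) ^ (2 - τ) * f (x * y)) /
        (∫ x in a..b, x ^ (1 - τ)) ^ 2) :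
    ∀ b₁ b₂ : ℝ, a < b₁ → b₁ ≤ b₂ → G b₁ ≤ G b₂ := by
  intro b₁ b₂ h₁ h₂
  have hcont : ∀ b, ContinuousOn (fun x : ℝ => x ^ (1 - τ)) (Icc a b) := fun b x hx =>
    (Real.continuousAt_rpow_const x _ (Or.inl (ha.trans_le hx.1).ne')).continuousWithinAt
  have hnum : ∀ b, a < b → (∫ x in a..b, ∫ y in a..b, (x * y) ^ (2 - τ) * f (x * y)) =
      ∫ x in a..b, x ^ (1 - τ) * ∫ y in a..b, y ^ (1 - τ) * (x * y * f (x * y)) := by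
    intro b hb
    refine intervalIntegral.integral_congr fun x hx => ?_
    rw [uIcc_of_le hb.le] at hx
    have hx0 : 0 < x := ha.trans_le hx.1
    rw [← intervalIntegral.integral_const_mul]
    refine intervalIntegral.integral_congr fun y hy => ?_
    rw [uIcc_of_le hb.le] at hy
    have hy0 : 0 < y := ha.trans_le hy.1
    rw [show 2 - τ = (1 - τ) + 1 by ring, Real.rpow_add_one (mul_pos hx0 hy0).ne',
      Real.mul_rpow hx0.le hy0.le]
    ring
  have hpos : ∀ b, a < b → 0 < ∫ x in a..b, x ^ (1 - τ) := fun b hb =>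
    intervalIntegral.intervalIntegral_pos_of_pos_on
      ((hcont b).intervalIntegrable_of_Icc hb.le)
      (fun x hx => Real.rpow_pos_of_pos (ha.trans hx.1) _) hb
  have h₃ := h₁.trans_le h₂
  rw [hG, hG, hnum b₁ h₁, hnum b₂ h₃,
    div_le_div_iff₀ (pow_pos (hpos b₁ h₁) 2) (pow_pos (hpos b₂ h₃) 2)]
  exact integral_integral_mul_sq_le_of_monotoneOn (g := fun u => u * f u) ha h₁.le h₂ (hcont b₂)
    (fun x hx => Real.rpow_nonneg (ha.le.trans hx.1) _) hF2
end

section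
/- Let f : (0,∞) → (0,∞) be continuous with u ↦ u·f(u) monotone non-decreasing. Fix a real exponent τ and a real number b > 0. Define, for 0 < a < b, G(a) = (∫_a^b ∫_a^b (x·y)^(2−τ) f(x·y) dx dy) / (∫_a^b x^(1−τ) dx)^2. Then G is monotone non-decreasing in a on (0,b): for all 0 < a₁ ≤ a₂ < b, G(a₁) ≤ G(a₂). -/
open MeasureTheory Set

/-- The average of `g` over the interval from `a` to `b` with weight `w`. -/
noncomputable def weightedMean (w g : ℝ → ℝ) (a b : ℝ) : ℝ :=
  (∫ x in a..b, g x * w x) / ∫ x in a..b, w x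

theorem MonotoneOn.intervalIntegrable_mul_continuousOn {w g : ℝ → ℝ} {a b : ℝ} (hab : a ≤ b)
    (hg : MonotoneOn g (Icc a b)) (hw : ContinuousOn w (Icc a b)) :
    IntervalIntegrable (fun x => g x * w x) volume a b := by
  rw [← uIcc_of_le hab] at hg hw
  exact hg.intervalIntegrable.mul_continuousOn hw

theorem intervalIntegral_pos_of_continuousOn {w : ℝ → ℝ} {a b : ℝ} (hab : a < b)
    (hw : ContinuousOn w (Icc a b)) (hpos : ∀ x ∈ Icc a b, 0 < w x) :
    0 < ∫ x in a..b, w x :=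
  intervalIntegral.intervalIntegral_pos_of_pos_on (hw.intervalIntegrable_of_Icc hab.le)
    (fun x hx => hpos x (Ioo_subset_Icc_self hx)) hab

theorem weightedMean_mono {w g₁ g₂ : ℝ → ℝ} {a b : ℝ} (hab : a < b)
    (hw : ContinuousOn w (Icc a b)) (hpos : ∀ x ∈ Icc a b, 0 < w x)
    (hg₁ : MonotoneOn g₁ (Icc a b)) (hg₂ : MonotoneOn g₂ (Icc a b))
    (hle : ∀ x ∈ Icc a b, g₁ x ≤ g₂ x) :
    weightedMean w g₁ a b ≤ weightedMean w g₂ a b :=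
  div_le_div_of_nonneg_right
    (intervalIntegral.integral_mono_on hab.le
      (hg₁.intervalIntegrable_mul_continuousOn hab.le hw)
      (hg₂.intervalIntegrable_mul_continuousOn hab.le hw)
      fun x hx => mul_le_mul_of_nonneg_right (hle x hx) (hpos x hx).le)
    (intervalIntegral_pos_of_continuousOn hab hw hpos).le

/-- The weighted mean of a monotone function increases with the left endpoint. -/
theorem MonotoneOn.weightedMean_le_of_left_le {w g : ℝ → ℝ} {a c b : ℝ} (hac : a ≤ c)
    (hcb : c < b) (hw : ContinuousOn w (Icc a b)) (hpos : ∀ x ∈ Icc a b, 0 < w x)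
    (hg : MonotoneOn g (Icc a b)) :
    weightedMean w g a b ≤ weightedMean w g c b := by
  have hl : Icc a c ⊆ Icc a b := Icc_subset_Icc_right hcb.le
  have hr : Icc c b ⊆ Icc a b := Icc_subset_Icc_left hac
  have hc : c ∈ Icc a b := ⟨hac, hcb.le⟩
  have iwl := (hw.mono hl).intervalIntegrable_of_Icc (μ := volume) hac
  have iwr := (hw.mono hr).intervalIntegrable_of_Icc (μ := volume) hcb.le
  have igl := (hg.mono hl).intervalIntegrable_mul_continuousOn hac (hw.mono hl)
  have igr := (hg.mono hr).intervalIntegrable_mul_continuousOn hcb.le (hw.mono hr)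
  have hQ := intervalIntegral_pos_of_continuousOn hcb (hw.mono hr) fun x hx => hpos x (hr hx)
  have hP : 0 ≤ ∫ x in a..c, w x :=
    intervalIntegral.integral_nonneg hac fun x hx => (hpos x (hl hx)).le
  have hA : ∫ x in a..c, g x * w x ≤ g c * ∫ x in a..c, w x := by
    rw [← intervalIntegral.integral_const_mul]
    exact intervalIntegral.integral_mono_on hac igl (iwl.const_mul _) fun x hx =>
      mul_le_mul_of_nonneg_right (hg (hl hx) hc hx.2) (hpos x (hl hx)).le
  have hB : g c * ∫ x in c..b, w x ≤ ∫ x in c..b, g x * w x := by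
    rw [← intervalIntegral.integral_const_mul]
    exact intervalIntegral.integral_mono_on hcb.le (iwr.const_mul _) igr fun x hx =>
      mul_le_mul_of_nonneg_right (hg hc (hr hx) hx.1) (hpos x (hr hx)).le
  unfold weightedMean
  rw [← intervalIntegral.integral_add_adjacent_intervals igl igr,
    ← intervalIntegral.integral_add_adjacent_intervals iwl iwr,
    div_le_div_iff₀ (by linarith) hQ]
  linarith [mul_le_mul_of_nonneg_right hA hQ.le, mul_le_mul_of_nonneg_right hB hP]

/-- Iterated weighted means of `h (x * y)` increase with the left endpoint, for monotone `h`. -/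
theorem MonotoneOn.weightedMean_weightedMean_le {w h : ℝ → ℝ} {a c b : ℝ} (ha : 0 < a)
    (hac : a ≤ c) (hcb : c < b) (hw : ContinuousOn w (Icc a b))
    (hpos : ∀ x ∈ Icc a b, 0 < w x) (hh : MonotoneOn h (Ioi 0)) :
    weightedMean w (fun x => weightedMean w (fun y => h (x * y)) a b) a b ≤
      weightedMean w (fun x => weightedMean w (fun y => h (x * y)) c b) c b := by
  have hr : Icc c b ⊆ Icc a b := Icc_subset_Icc_left hac
  have hslice : ∀ x, 0 < x → MonotoneOn (fun y => h (x * y)) (Icc a b) :=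
    fun x hx y hy z hz hyz => hh (mul_pos hx (ha.trans_le hy.1)) (mul_pos hx (ha.trans_le hz.1))
      (mul_le_mul_of_nonneg_left hyz hx.le)
  have hmean : ∀ d, a ≤ d → d < b →
      MonotoneOn (fun x => weightedMean w (fun y => h (x * y)) d b) (Icc a b) := by
    intro d had hdb x hx z hz hxz
    have hd : Icc d b ⊆ Icc a b := Icc_subset_Icc_left had
    have hx0 := ha.trans_le hx.1
    have hz0 := ha.trans_le hz.1
    refine weightedMean_mono hdb (hw.mono hd) (fun y hy => hpos y (hd hy))
      ((hslice x hx0).mono hd) ((hslice z hz0).mono hd) fun y hy => ?_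
    have hy0 := ha.trans_le (hd hy).1
    exact hh (mul_pos hx0 hy0) (mul_pos hz0 hy0) (mul_le_mul_of_nonneg_right hxz hy0.le)
  have hab := hac.trans_lt hcb
  refine ((hmean a le_rfl hab).weightedMean_le_of_left_le hac hcb hw hpos).trans ?_
  exact weightedMean_mono hcb (hw.mono hr) (fun x hx => hpos x (hr hx))
    ((hmean a le_rfl hab).mono hr) ((hmean c hac hcb).mono hr) fun x hx =>
      (hslice x (ha.trans_le (hr hx).1)).weightedMean_le_of_left_le hac hcb hw hpos

theorem integral_integral_div_sq_eq_weightedMean (f : ℝ → ℝ) (τ : ℝ) {a b : ℝ} (ha : 0 < a)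
    (hab : a ≤ b) :
    (∫ x in a..b, ∫ y in a..b, (x * y) ^ (2 - τ) * f (x * y)) /
        (∫ x in a..b, x ^ (1 - τ)) ^ 2 =
      weightedMean (fun x => x ^ (1 - τ))
        (fun x => weightedMean (fun y => y ^ (1 - τ)) (fun y => x * y * f (x * y)) a b) a b := by
  have key : ∀ x ∈ uIcc a b, ∫ y in a..b, (x * y) ^ (2 - τ) * f (x * y) =
      (∫ y in a..b, x * y * f (x * y) * y ^ (1 - τ)) * x ^ (1 - τ) := by
    intro x hx
    rw [uIcc_of_le hab] at hx
    have hx0 := ha.trans_le hx.1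
    rw [← intervalIntegral.integral_mul_const]
    refine intervalIntegral.integral_congr fun y hy => ?_
    rw [uIcc_of_le hab] at hy
    have hy0 := ha.trans_le hy.1
    have hpow : (x * y) ^ (2 - τ) = x * y * (x ^ (1 - τ) * y ^ (1 - τ)) := by
      rw [← Real.mul_rpow hx0.le hy0.le, show 2 - τ = 1 + (1 - τ) by ring,
        Real.rpow_add (mul_pos hx0 hy0), Real.rpow_one]
    simp only [hpow]
    ring
  rw [intervalIntegral.integral_congr key]
  simp only [weightedMean, div_mul_eq_mul_div, intervalIntegral.integral_div]
  rw [div_div, sq]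

theorem G_monotone_in_a
    (f : ℝ → ℝ)
    (hfc : ContinuousOn f (Ioi 0))
    (hfpos : ∀ u ∈ Ioi (0:ℝ), 0 < f u)
    (hF2 : MonotoneOn (fun u => u * f u) (Ioi 0))
    (τ b : ℝ) (hb : 0 < b)
    (G : ℝ → ℝ)
    (hG : ∀ a : ℝ, G a =
      (∫ x in a..b, ∫ y in a..b, (x * y) ^ (2 - τ) * f (x * y)) /
        (∫ x in a..b, x ^ (1 - τ)) ^ 2) :
    ∀ a₁ a₂ : ℝ, 0 < a₁ → a₁ ≤ a₂ → a₂ < b → G a₁ ≤ G a₂ := by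
  intro a₁ a₂ h₁ h₁₂ h₂
  rw [hG, hG, integral_integral_div_sq_eq_weightedMean f τ h₁ (h₁₂.trans h₂.le),
    integral_integral_div_sq_eq_weightedMean f τ (h₁.trans_le h₁₂) h₂.le]
  refine hF2.weightedMean_weightedMean_le h₁ h₁₂ h₂ ?_ fun x hx =>
    Real.rpow_pos_of_pos (h₁.trans_le hx.1) _
  exact continuousOn_id.rpow_const fun x hx => Or.inl (h₁.trans_le hx.1).ne'
end

section
/- Let τ > 2 be real, let h_min > 0, and let N ≥ 1 be a natural number. Then ∫_{h_min}^∞ h · N·(τ−1)·h_min^(τ−1)·h^(−τ) · (1 − (h/h_min)^(1−τ))^(N−1) dh = h_min · Γ((τ−2)/(τ−1)) · Γ(N+1) / Γ(N + (τ−2)/(τ−1)), where Γ is the Gamma function. Equivalently, if h̲₁, …, h̲_N are i.i.d. random variables with density ρ(h) = (τ−1)·h_min^(τ−1)·h^(−τ) on [h_min, ∞), then E[max(h̲₁,…,h̲_N)] = h_min · Γ((τ−2)/(τ−1)) · Γ(N+1) / Γ(N + (τ−2)/(τ−1)). -/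
open MeasureTheory Set

theorem integral_Ioo_rpow_mul_one_sub_rpow {α β : ℝ} (hα : 0 < α) (hβ : 0 < β) :
    ∫ t in Ioo (0 : ℝ) 1, t ^ (α - 1) * (1 - t) ^ (β - 1) =
      Real.Gamma α * Real.Gamma β / Real.Gamma (α + β) := by
  have h := ProbabilityTheory.beta_eq_betaIntegralReal α β hα hβ
  rw [ProbabilityTheory.beta] at h
  rw [h, Complex.betaIntegral, intervalIntegral.integral_of_le zero_le_one,
    integral_Ioc_eq_integral_Ioo, ← Complex.ofReal_re (∫ t in Ioo (0 : ℝ) 1, _),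
    ← integral_complex_ofReal]
  congr 1
  refine setIntegral_congr_fun measurableSet_Ioo fun t ht => ?_
  have h1 : 0 ≤ 1 - t := by linarith [ht.2]
  simp only [Complex.ofReal_mul, Complex.ofReal_cpow ht.1.le, Complex.ofReal_cpow h1]
  push_cast
  rfl

theorem image_div_rpow_Ioi {c p : ℝ} (hc : 0 < c) (hp : p < 0) :
    (fun x : ℝ => (x / c) ^ p) '' Ioi c = Ioo 0 1 := by
  ext t
  constructor
  · rintro ⟨x, hx, rfl⟩
    have hxc : 1 < x / c := (one_lt_div hc).2 hx
    exact ⟨Real.rpow_pos_of_pos (zero_lt_one.trans hxc) _,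
      Real.rpow_lt_one_of_one_lt_of_neg hxc hp⟩
  · rintro ⟨h0, h1⟩
    refine ⟨c * t ^ p⁻¹, ?_, ?_⟩
    · exact lt_mul_of_one_lt_right hc
        (Real.one_lt_rpow_of_pos_of_lt_one_of_neg h0 h1 (inv_lt_zero.2 hp))
    · simp only [mul_div_cancel_left₀ _ hc.ne']
      exact Real.rpow_inv_rpow h0.le hp.ne

theorem injOn_div_rpow_Ioi {c p : ℝ} (hc : 0 < c) (hp : p ≠ 0) :
    InjOn (fun x : ℝ => (x / c) ^ p) (Ioi c) := by
  intro x hx y hy hxy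
  have h := (Real.rpow_left_inj (div_pos (hc.trans hx) hc).le
    (div_pos (hc.trans hy) hc).le hp).1 hxy
  exact (div_left_inj' hc.ne').1 h

theorem expected_max_pareto
    (τ hmin : ℝ) (hτ : 2 < τ) (hmin_pos : 0 < hmin)
    (N : ℕ) (hN : 1 ≤ N) :
    ∫ h in Ioi hmin,
        h * ((N : ℝ) * (τ - 1) * hmin ^ (τ - 1) * h ^ (-τ) *
          (1 - (h / hmin) ^ (1 - τ)) ^ (N - 1)) =
      hmin * Real.Gamma ((τ - 2) / (τ - 1)) * Real.Gamma ((N : ℝ) + 1) /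
        Real.Gamma ((N : ℝ) + (τ - 2) / (τ - 1)) := by
  have hτ1 : 0 < τ - 1 := by linarith
  have hN0 : (0 : ℝ) < N := by exact_mod_cast hN
  have ha : 0 < (τ - 2) / (τ - 1) := div_pos (by linarith) hτ1
  set a := (τ - 2) / (τ - 1) with ha_def
  have hexp : (1 - τ) * (a - 1) = 1 := by
    rw [ha_def]
    field_simp
    ring
  have hderiv : ∀ x ∈ Ioi hmin, HasDerivWithinAt (fun x : ℝ => (x / hmin) ^ (1 - τ))
      (1 / hmin * (1 - τ) * (x / hmin) ^ (1 - τ - 1)) (Ioi hmin) x := fun x hx =>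
    (((hasDerivAt_id x).div_const hmin).rpow_const
      (Or.inl (div_pos (hmin_pos.trans hx) hmin_pos).ne')).hasDerivWithinAt
  have hsubst := integral_image_eq_integral_abs_deriv_smul measurableSet_Ioi hderiv
    (injOn_div_rpow_Ioi hmin_pos (by linarith))
    (fun t => (N * hmin) * (t ^ (a - 1) * (1 - t) ^ ((N : ℝ) - 1)))
  rw [image_div_rpow_Ioi hmin_pos (by linarith), integral_const_mul,
    integral_Ioo_rpow_mul_one_sub_rpow ha hN0] at hsubst
  rw [Real.Gamma_add_one hN0.ne', add_comm (N : ℝ) a]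
  trans N * hmin * (Real.Gamma a * Real.Gamma N / Real.Gamma (a + N))
  · rw [hsubst]
    refine setIntegral_congr_fun measurableSet_Ioi fun x hx => ?_
    have hx0 : 0 < x := hmin_pos.trans hx
    have hy : 0 < x / hmin := div_pos hx0 hmin_pos
    have habs : |1 / hmin * (1 - τ) * (x / hmin) ^ (1 - τ - 1)| =
        1 / hmin * (τ - 1) * (x / hmin) ^ (-τ) := by
      rw [show 1 - τ - 1 = -τ by ring, abs_mul, abs_mul, abs_of_pos (by positivity),
        abs_of_neg (by linarith : 1 - τ < 0), abs_of_pos (Real.rpow_pos_of_pos hy _)]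
      ring
    have hpow : (1 - (x / hmin) ^ (1 - τ)) ^ ((N : ℝ) - 1) =
        (1 - (x / hmin) ^ (1 - τ)) ^ (N - 1) := by
      rw [← Real.rpow_natCast, Nat.cast_sub hN, Nat.cast_one]
    have hscale : (x / hmin) ^ (-τ) = x ^ (-τ) * hmin ^ τ := by
      rw [Real.div_rpow hx0.le hmin_pos.le, Real.rpow_neg hmin_pos.le, div_inv_eq_mul]
    simp only [smul_eq_mul, habs, hpow, hscale]
    rw [← Real.rpow_mul hy.le, hexp, Real.rpow_one, Real.rpow_sub_one hmin_pos.ne']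
    field_simp
  · ring
end

section
/- For every real u with 0 < u ≤ 1/2, it holds that u^u ≤ Γ(1+u) ≤ (4/3)·u^u, where Γ is the Gamma function. -/
/-- `log Γ` lies above its tangent line at `1`. -/
lemma neg_eulerMascheroniConstant_mul_le_log_Gamma_one_add {u : ℝ} (hu : 0 < u) :
    -Real.eulerMascheroniConstant * u ≤ Real.log (Real.Gamma (1 + u)) := by
  have hderiv : HasDerivAt (Real.log ∘ Real.Gamma) (-Real.eulerMascheroniConstant) 1 := by
    have h := Real.hasDerivAt_Gamma_one.log (by simp)
    simpa [Function.comp_def] using h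
  have h := Real.convexOn_log_Gamma.le_slope_of_hasDerivAt (x := 1) (y := 1 + u)
    (by simp) (by simp only [Set.mem_Ioi]; linarith) (by linarith) hderiv
  rw [slope_def_field, le_div_iff₀ (by linarith)] at h
  simpa using h

/-- `log Γ` lies below its chord between `2` and `5 / 2`. -/
lemma log_Gamma_two_add_le {u : ℝ} (hu : 0 ≤ u) (hu2 : u ≤ 1 / 2) :
    Real.log (Real.Gamma (2 + u)) ≤ u * Real.log (9 * Real.pi / 16) := by
  have hval : Real.Gamma (5 / 2) = 3 / 4 * √Real.pi := by
    rw [show (5 / 2 : ℝ) = 1 / 2 + 1 + 1 by norm_num, Real.Gamma_add_one (by norm_num),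
      Real.Gamma_add_one (by norm_num), Real.Gamma_one_half_eq]
    ring
  have hlog : 2 * Real.log (Real.Gamma (5 / 2)) = Real.log (9 * Real.pi / 16) := by
    rw [hval, ← Real.log_rpow (by positivity)]
    congr 1
    rw [Real.rpow_two, mul_pow, Real.sq_sqrt Real.pi_pos.le]
    ring
  have h := Real.convexOn_log_Gamma.2 (x := 2) (y := 5 / 2) (by simp) (by norm_num)
    (show 0 ≤ 1 - 2 * u by linarith) (show 0 ≤ 2 * u by linarith) (by ring)
  simp only [smul_eq_mul, Function.comp_apply, Real.Gamma_two, Real.log_one] at h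
  rw [show (1 - 2 * u) * 2 + 2 * u * (5 / 2) = 2 + u by ring] at h
  linear_combination h + u * hlog

/-- The concave function `u ↦ u * log (a / u)` lies below its tangent line at `v`. -/
lemma mul_log_sub_mul_log_le {a u v : ℝ} (ha : 0 < a) (hu : 0 < u) (hv : 0 < v) :
    u * Real.log a - u * Real.log u ≤ v - u + u * Real.log (a / v) := by
  have h := mul_le_mul_of_nonneg_left (Real.log_le_sub_one_of_pos (div_pos hv hu)) hu.le
  rw [Real.log_div hv.ne' hu.ne', mul_sub u (v / u), mul_div_cancel₀ _ hu.ne'] at h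
  rw [Real.log_div ha.ne' hv.ne']
  linarith

lemma log_nine_mul_pi_div_four_le : Real.log (9 * Real.pi / 16 / (1 / 4)) ≤ 2 := by
  rw [Real.log_le_iff_le_exp (by positivity), show (2 : ℝ) = 1 + 1 by norm_num, Real.exp_add]
  nlinarith [Real.pi_lt_d2, Real.exp_one_gt_d9]

lemma log_twentySeven_mul_pi_div_sixteen_le :
    Real.log (9 * Real.pi / 16 / (1 / 3)) ≤ 27 / 16 := by
  rw [Real.log_le_iff_le_exp (by positivity), show (27 / 16 : ℝ) = 1 + 11 / 16 by norm_num,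
    Real.exp_add]
  have h := Real.sum_le_exp_of_nonneg (show (0 : ℝ) ≤ 11 / 16 by norm_num) 4
  norm_num [Finset.sum_range_succ, Nat.factorial] at h
  nlinarith [Real.pi_lt_d2, Real.exp_one_gt_d9]

lemma log_Gamma_one_add_sub_mul_log_le {u : ℝ} (hu : 0 < u) (hu2 : u ≤ 1 / 2) :
    Real.log (Real.Gamma (1 + u)) - u * Real.log u ≤ Real.log (4 / 3) := by
  have hrec : Real.log (Real.Gamma (2 + u)) =
      Real.log (1 + u) + Real.log (Real.Gamma (1 + u)) := by
    rw [show 2 + u = 1 + u + 1 by ring, Real.Gamma_add_one (by positivity),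
      Real.log_mul (by positivity) (Real.Gamma_pos_of_pos (by positivity)).ne']
  have hchord := log_Gamma_two_add_le hu.le hu2
  have hlog := Real.le_log_one_add_of_nonneg hu.le
  have hfour := Real.le_log_one_add_of_nonneg (show (0 : ℝ) ≤ 1 / 3 by norm_num)
  norm_num at hfour
  have hpi : 0 < 9 * Real.pi / 16 := by positivity
  rcases le_total u (1 / 4) with h | h
  · have htangent := mul_log_sub_mul_log_le hpi hu (show (0 : ℝ) < 1 / 4 by norm_num)
    have hmul := mul_le_mul_of_nonneg_left log_nine_mul_pi_div_four_le hu.le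
    have hrat : 1 / 4 + u - 2 / 7 ≤ 2 * u / (u + 2) := by
      rw [le_div_iff₀ (by positivity)]
      nlinarith
    linarith
  · have htangent := mul_log_sub_mul_log_le hpi hu (show (0 : ℝ) < 1 / 3 by norm_num)
    have hmul := mul_le_mul_of_nonneg_left log_twentySeven_mul_pi_div_sixteen_le hu.le
    have hrat : 1 / 3 + 11 / 16 * u - 2 / 7 ≤ 2 * u / (u + 2) := by
      rw [le_div_iff₀ (by positivity)]
      nlinarith
    linarith

theorem gamma_one_add_u_bounds
    (u : ℝ) (hu : 0 < u) (hu2 : u ≤ 1 / 2) :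
    u ^ u ≤ Real.Gamma (1 + u) ∧ Real.Gamma (1 + u) ≤ 4 / 3 * u ^ u := by
  have hG : 0 < Real.Gamma (1 + u) := Real.Gamma_pos_of_pos (by positivity)
  have hpow : 0 < u ^ u := Real.rpow_pos_of_pos hu u
  constructor
  · rw [← Real.log_le_log_iff hpow hG, Real.log_rpow hu]
    have hlog : Real.log u ≤ -Real.eulerMascheroniConstant := by
      have h := Real.log_le_log hu hu2
      rw [one_div, Real.log_inv] at h
      linarith [Real.log_two_gt_d9, Real.eulerMascheroniConstant_lt_two_thirds]
    linarith [neg_eulerMascheroniConstant_mul_le_log_Gamma_one_add hu,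
      mul_le_mul_of_nonneg_left hlog hu.le]
  · rw [← Real.log_le_log_iff hG (by positivity), Real.log_mul (by norm_num) hpow.ne',
      Real.log_rpow hu]
    linarith [log_Gamma_one_add_sub_mul_log_le hu hu2]
end

section
/- For every real τ with 2 < τ ≤ 3, it holds that ((τ−1)/(τ−2))^(1/(τ−1)) ≤ Γ((τ−2)/(τ−1)) ≤ (4/3)·((τ−1)/(τ−2))^(1/(τ−1)), where Γ is the Gamma function. -/
theorem rpow_self_le_Gamma_one_add {u : ℝ} (hu : 0 < u) (hu2 : u ≤ 1 / 2) :
    u ^ u ≤ Real.Gamma (1 + u) := by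
  have hG : 0 < Real.Gamma (1 + u) := Real.Gamma_pos_of_pos (by linarith)
  have hd : HasDerivAt (Real.log ∘ Real.Gamma) (-Real.eulerMascheroniConstant) 1 := by
    have h := Real.hasDerivAt_Gamma_one.log (by simp)
    simpa [Function.comp_def] using h
  have hs := Real.convexOn_log_Gamma.le_slope_of_hasDerivAt (x := 1) (y := 1 + u)
    (by simp) (by simp; linarith) (by linarith) hd
  simp only [slope_def_field, Function.comp_apply, Real.Gamma_one, Real.log_one, sub_zero,
    add_sub_cancel_left] at hs
  rw [le_div_iff₀ hu] at hs
  have hγ := Real.eulerMascheroniConstant_lt_two_thirds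
  have hl : Real.log u ≤ -Real.log 2 := by
    rw [← Real.log_inv]
    exact Real.log_le_log hu (by linarith)
  have h2 := Real.log_two_gt_d9
  rw [Real.rpow_def_of_pos hu, ← Real.le_log_iff_exp_le hG]
  nlinarith

theorem log_Gamma_one_add_le {u : ℝ} (hu : 0 < u) (hu2 : u ≤ 1 / 2) :
    Real.log (Real.Gamma (1 + u)) ≤ u * Real.log (9 * Real.pi / 16) - Real.log (1 + u) := by
  have hG : 0 < Real.Gamma (1 + u) := Real.Gamma_pos_of_pos (by linarith)
  have h52 : Real.Gamma (5 / 2) = 3 / 4 * √Real.pi := by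
    rw [show (5 / 2 : ℝ) = 1 / 2 + 1 + 1 by norm_num, Real.Gamma_add_one (by norm_num),
      Real.Gamma_add_one (by norm_num), Real.Gamma_one_half_eq]
    ring
  have hc := Real.convexOn_log_Gamma.2 (Set.mem_Ioi.2 (show (0 : ℝ) < 2 by norm_num))
    (Set.mem_Ioi.2 (show (0 : ℝ) < 5 / 2 by norm_num))
    (show 0 ≤ 1 - 2 * u by linarith) (show 0 ≤ 2 * u by linarith) (by ring)
  simp only [smul_eq_mul, Function.comp_apply, Real.Gamma_two, Real.log_one, mul_zero,
    zero_add] at hc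
  rw [show (1 - 2 * u) * 2 + 2 * u * (5 / 2) = (1 + u) + 1 by ring,
    Real.Gamma_add_one (by linarith), Real.log_mul (by linarith) hG.ne', h52] at hc
  have hsq : Real.log (9 * Real.pi / 16) = 2 * Real.log (3 / 4 * √Real.pi) := by
    rw [show 9 * Real.pi / 16 = (3 / 4 * √Real.pi) ^ 2 by
      rw [mul_pow, Real.sq_sqrt Real.pi_pos.le]; ring, Real.log_pow]
    norm_num
  rw [hsq]
  linarith

theorem mul_log_add_sub_le_mul_log {u c : ℝ} (hu : 0 < u) (hc : 0 < c) :
    u * Real.log c + u - c ≤ u * Real.log u := by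
  have h := Real.log_le_sub_one_of_pos (div_pos hc hu)
  rw [Real.log_div hc.ne' hu.ne'] at h
  have h' := mul_le_mul_of_nonneg_left h hu.le
  have : u * (c / u - 1) = c - u := by field_simp
  linarith

theorem Gamma_one_add_le_four_thirds_mul_rpow_self {u : ℝ} (hu : 0 < u) (hu2 : u ≤ 1 / 2) :
    Real.Gamma (1 + u) ≤ 4 / 3 * u ^ u := by
  have hG : 0 < Real.Gamma (1 + u) := Real.Gamma_pos_of_pos (by linarith)
  have hup := log_Gamma_one_add_le hu hu2
  have hlog := Real.le_log_one_add_of_nonneg hu.le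
  have h43 : 2 / 7 ≤ Real.log (4 / 3) := by
    have h := Real.le_log_one_add_of_nonneg (x := 1 / 3) (by norm_num)
    norm_num at h
    exact h
  have hπ := Real.pi_lt_d2
  have hpos := Real.pi_pos
  have he := Real.exp_one_gt_d9
  rw [← Real.log_le_log_iff hG (by positivity), Real.log_mul (by norm_num) (by positivity),
    Real.log_rpow hu]
  rcases le_total u (27 / 100) with h | h
  · have ht := mul_log_add_sub_le_mul_log hu (c := 1 / 4) (by norm_num)
    have hk : Real.log (9 * Real.pi / 16) - Real.log (1 / 4) ≤ 2 := by
      rw [← Real.log_div (by positivity) (by norm_num), Real.log_le_iff_le_exp (by positivity),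
        show (2 : ℝ) = (2 : ℕ) * 1 by norm_num, Real.exp_nat_mul]
      nlinarith
    have hr : u - 2 * u / (u + 2) + 1 / 4 ≤ 2 / 7 := by
      rw [← sub_nonneg]
      have : 2 / 7 - (u - 2 * u / (u + 2) + 1 / 4) = (1 / 14 + u / 28 - u ^ 2) / (u + 2) := by
        field_simp; ring
      rw [this]
      exact div_nonneg (by nlinarith) (by linarith)
    nlinarith [mul_le_mul_of_nonneg_left hk hu.le]
  · have ht := mul_log_add_sub_le_mul_log hu (c := 1 / 3) (by norm_num)
    have hk : Real.log (9 * Real.pi / 16) - Real.log (1 / 3) ≤ 17 / 10 := by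
      rw [← Real.log_div (by positivity) (by norm_num)]
      have h10 : Real.log ((9 * Real.pi / 16 / (1 / 3)) ^ 10) ≤ 17 := by
        rw [Real.log_le_iff_le_exp (by positivity),
          show (17 : ℝ) = (17 : ℕ) * 1 by norm_num, Real.exp_nat_mul]
        calc (9 * Real.pi / 16 / (1 / 3)) ^ 10 ≤ (5.32 : ℝ) ^ 10 :=
              pow_le_pow_left₀ (by positivity) (by linarith) 10
          _ ≤ (2.718 : ℝ) ^ 17 := by norm_num
          _ ≤ Real.exp 1 ^ 17 := pow_le_pow_left₀ (by norm_num) (by linarith) 17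
      rw [Real.log_pow] at h10
      push_cast at h10
      linarith
    have hr : 7 / 10 * u - 2 * u / (u + 2) + 1 / 3 ≤ 2 / 7 := by
      rw [← sub_nonneg]
      have : 2 / 7 - (7 / 10 * u - 2 * u / (u + 2) + 1 / 3)
          = (-(2 / 21) + 58 / 105 * u - 7 / 10 * u ^ 2) / (u + 2) := by
        field_simp; ring
      rw [this]
      exact div_nonneg (by nlinarith) (by linarith)
    nlinarith [mul_le_mul_of_nonneg_left hk hu.le]

theorem gamma_bounds_for_tau
    (τ : ℝ) (hτ2 : 2 < τ) (hτ3 : τ ≤ 3) :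
    ((τ - 1) / (τ - 2)) ^ (1 / (τ - 1)) ≤ Real.Gamma ((τ - 2) / (τ - 1)) ∧
      Real.Gamma ((τ - 2) / (τ - 1)) ≤
        4 / 3 * ((τ - 1) / (τ - 2)) ^ (1 / (τ - 1)) := by
  have h1 : 0 < τ - 1 := by linarith
  have h2 : 0 < τ - 2 := by linarith
  obtain ⟨u, hu⟩ : ∃ u, u = (τ - 2) / (τ - 1) := ⟨_, rfl⟩
  have hu0 : 0 < u := hu ▸ div_pos h2 h1
  have hu2 : u ≤ 1 / 2 := by
    rw [hu, div_le_div_iff₀ h1 (by norm_num)]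
    linarith
  have hbase : (τ - 1) / (τ - 2) = u⁻¹ := by rw [hu, inv_div]
  have hexp : 1 / (τ - 1) = 1 - u := by
    rw [hu]
    field_simp
    ring
  have hpow : u⁻¹ ^ (1 - u) = u ^ u / u := by
    rw [Real.inv_rpow hu0.le, ← Real.rpow_neg hu0.le, neg_sub, Real.rpow_sub_one hu0.ne']
  have hΓ : Real.Gamma (1 + u) = u * Real.Gamma u := by
    rw [add_comm, Real.Gamma_add_one hu0.ne']
  have hlo := rpow_self_le_Gamma_one_add hu0 hu2
  have hhi := Gamma_one_add_le_four_thirds_mul_rpow_self hu0 hu2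
  rw [hΓ] at hlo hhi
  rw [hbase, hexp, ← hu, hpow, ← mul_div_assoc, div_le_iff₀ hu0, le_div_iff₀ hu0]
  exact ⟨by linarith, by linarith⟩
end

section
/- Let f : (0,∞) → (0,∞) be continuously differentiable, and set z(v) = −v·f'(v)/f(v). Suppose there exist u₀ > ε > 0 such that u ↦ u·f(u) is strictly increasing on [u₀−ε, u₀+ε], and v₀ > δ > 0 such that z is strictly decreasing on [v₀−δ, v₀+δ]. Then for every real τ there exist real numbers a, b, h with (u₀−ε)^(1/2) ≤ a < b ≤ (u₀+ε)^(1/2), a/b ≥ (v₀−δ)/(v₀+δ), and h > 0 satisfying a²h ≥ v₀−δ and a·b·h ≤ v₀+δ, such that ∫_a^b z(a·h·x)·T(x) dx < ∫_a^b z(a·h·x)·U(x) dx, where T(x) = f(a·h·x)·(∫_a^b f(a·h·y) f(x·y) (x·y)^(2−τ) dy) / (∫_a^b ∫_a^b f(a·h·v) f(a·h·y) f(v·y) (v·y)^(2−τ) dv dy) and U(x) = f(a·h·x)·x^(1−τ) / (∫_a^b f(a·h·v)·v^(1−τ) dv); consequently the derivative of h ↦ c_{a,b}(h) = (∫_a^b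 ∫_a^b (x·y)^(2−τ) f(ahx) f(ahy) f(xy) dx dy)/(∫_a^b x^(1−τ) f(ahx) dx)² at this h is strictly positive, so c_{a,b} is not monotone non-increasing. -/
open MeasureTheory Set

/-- A strict form of Chebyshev's integral inequality for oppositely ordered functions with respect
to a positive weight. -/
theorem integral_mul_mul_integral_lt_of_strictAntiOn_of_strictMonoOn {a b : ℝ} (hab : a < b)
    {w Z G : ℝ → ℝ} (hw : ContinuousOn w (Icc a b)) (hZ : ContinuousOn Z (Icc a b))
    (hG : ContinuousOn G (Icc a b)) (hwpos : ∀ x ∈ Icc a b, 0 < w x)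
    (hZanti : StrictAntiOn Z (Icc a b)) (hGmono : StrictMonoOn G (Icc a b)) :
    (∫ x in a..b, Z x * (w x * G x)) * (∫ x in a..b, w x) <
      (∫ x in a..b, Z x * w x) * (∫ x in a..b, w x * G x) := by
  have hint : ∀ {g : ℝ → ℝ}, ContinuousOn g (Icc a b) → IntervalIntegrable g volume a b :=
    fun hg => hg.intervalIntegrable_of_Icc hab.le
  obtain ⟨c, hc, hcZ⟩ : ∃ c ∈ Icc a b,
      (∫ x in a..b, Z x * w x) = Z c * ∫ x in a..b, w x := by
    have := exists_eq_const_mul_intervalIntegral_of_nonneg (μ := volume) (a := a) (b := b)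
      (f := Z) (g := w) (by rwa [uIcc_of_le hab.le]) (hint hw)
      (fun x hx => (hwpos x (by
        rw [uIoc_of_le hab.le] at hx; exact Ioc_subset_Icc_self hx)).le)
    rwa [uIcc_of_le hab.le] at this
  have hwint : 0 < ∫ x in a..b, w x :=
    intervalIntegral.intervalIntegral_pos_of_pos_on (hint hw)
      (fun x hx => hwpos x (Ioo_subset_Icc_self hx)) hab
  have hneg : ∀ x ∈ Icc a b, x ≠ c → w x * ((Z x - Z c) * (G x - G c)) < 0 := by
    intro x hx hxc
    refine mul_neg_of_pos_of_neg (hwpos x hx) ?_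
    rcases lt_or_gt_of_ne hxc with h | h
    · exact mul_neg_of_pos_of_neg (sub_pos.2 (hZanti hx hc h)) (sub_neg.2 (hGmono hx hc h))
    · exact mul_neg_of_neg_of_pos (sub_neg.2 (hZanti hc hx h)) (sub_pos.2 (hGmono hc hx h))
  have hlt : (∫ x in a..b, w x * ((Z x - Z c) * (G x - G c))) < ∫ _ in a..b, (0 : ℝ) := by
    refine intervalIntegral.integral_lt_integral_of_continuousOn_of_le_of_exists_lt hab
      (by fun_prop) continuousOn_const (fun x hx => ?_) ?_
    · by_cases hxc : x = c
      · simp [hxc]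
      · exact (hneg x (Ioc_subset_Icc_self hx) hxc).le
    · by_cases hac : a = c
      · exact ⟨b, right_mem_Icc.2 hab.le, hneg b (right_mem_Icc.2 hab.le) (hac ▸ hab.ne')⟩
      · exact ⟨a, left_mem_Icc.2 hab.le, hneg a (left_mem_Icc.2 hab.le) hac⟩
  have hexp : (∫ x in a..b, w x * ((Z x - Z c) * (G x - G c))) =
      ((∫ x in a..b, Z x * (w x * G x)) - Z c * ∫ x in a..b, w x * G x) -
        (G c * (∫ x in a..b, Z x * w x) - Z c * G c * ∫ x in a..b, w x) := by
    simp only [← intervalIntegral.integral_const_mul]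
    rw [← intervalIntegral.integral_sub (hint (by fun_prop)) (hint (by fun_prop)),
      ← intervalIntegral.integral_sub (hint (by fun_prop)) (hint (by fun_prop)),
      ← intervalIntegral.integral_sub (hint (by fun_prop)) (hint (by fun_prop))]
    exact intervalIntegral.integral_congr fun x _ => by ring
  rw [hexp, hcZ, intervalIntegral.integral_zero] at hlt
  rw [hcZ]
  nlinarith

/-- Differentiation under the integral sign over a compact interval, for jointly continuous data. -/
theorem hasDerivAt_intervalIntegral_of_continuous {a b : ℝ} {φ φ' : ℝ → ℝ → ℝ}
    (hφ : Continuous φ.uncurry) (hφ' : Continuous φ'.uncurry)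
    (hd : ∀ t x, HasDerivAt (fun s => φ s x) (φ' t x) t) (t : ℝ) :
    HasDerivAt (fun s => ∫ x in a..b, φ s x) (∫ x in a..b, φ' t x) t := by
  obtain ⟨C, hC⟩ := ((isCompact_Icc (a := t - 1) (b := t + 1)).prod
    (isCompact_uIcc (a := a) (b := b))).exists_bound_of_continuousOn hφ'.continuousOn
  have hsec : ∀ {ψ : ℝ → ℝ → ℝ}, Continuous ψ.uncurry → ∀ s, Continuous (ψ s) :=
    fun hψ s => hψ.comp (Continuous.prodMk_right s)
  exact (intervalIntegral.hasDerivAt_integral_of_dominated_loc_of_deriv_le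
    (s := Icc (t - 1) (t + 1)) (bound := fun _ => C)
    (Icc_mem_nhds (by linarith) (by linarith))
    (Filter.Eventually.of_forall fun s => (hsec hφ s).aestronglyMeasurable)
    ((hsec hφ t).intervalIntegrable a b) (hsec hφ' t).aestronglyMeasurable
    (Filter.Eventually.of_forall fun x hx s hs => hC (s, x) ⟨hs, uIoc_subset_uIcc hx⟩)
    intervalIntegrable_const (Filter.Eventually.of_forall fun x _ s _ => hd s x)).2

/-- The derivative of a quadratic form in a family of functions depending on a parameter, for a
symmetric kernel. -/
theorem hasDerivAt_integral_integral_symm {a b : ℝ} {W W' k : ℝ → ℝ → ℝ}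
    (hW : Continuous W.uncurry) (hW' : Continuous W'.uncurry) (hk : Continuous k.uncurry)
    (hsymm : ∀ x y, k x y = k y x)
    (hd : ∀ t x, HasDerivAt (fun s => W s x) (W' t x) t) (t : ℝ) :
    HasDerivAt (fun s => ∫ x in a..b, ∫ y in a..b, k x y * W s x * W s y)
      (2 * ∫ x in a..b, W' t x * ∫ y in a..b, k x y * W t y) t := by
  have hW2 : ∀ {X : Type} [TopologicalSpace X] {u v : X → ℝ}, Continuous u → Continuous v →
      Continuous fun p => W (u p) (v p) := fun hu hv => hW.comp (hu.prodMk hv)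
  have hW2' : ∀ {X : Type} [TopologicalSpace X] {u v : X → ℝ}, Continuous u → Continuous v →
      Continuous fun p => W' (u p) (v p) := fun hu hv => hW'.comp (hu.prodMk hv)
  have hk2 : ∀ {X : Type} [TopologicalSpace X] {u v : X → ℝ}, Continuous u → Continuous v →
      Continuous fun p => k (u p) (v p) := fun hu hv => hk.comp (hu.prodMk hv)
  have inner : ∀ s x, HasDerivAt (fun s => ∫ y in a..b, k x y * W s x * W s y)
      (∫ y in a..b, (k x y * W' s x * W s y + k x y * W s x * W' s y)) s := by
    intro s x
    refine hasDerivAt_intervalIntegral_of_continuous (φ := fun s y => k x y * W s x * W s y)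
      (φ' := fun s y => k x y * W' s x * W s y + k x y * W s x * W' s y) ?_ ?_ ?_ s
    · exact ((hk2 continuous_const continuous_snd).mul (hW2 continuous_fst continuous_const)).mul
        (hW2 continuous_fst continuous_snd)
    · exact (((hk2 continuous_const continuous_snd).mul
        (hW2' continuous_fst continuous_const)).mul (hW2 continuous_fst continuous_snd)).add
        (((hk2 continuous_const continuous_snd).mul
        (hW2 continuous_fst continuous_const)).mul (hW2' continuous_fst continuous_snd))
    · intro s y
      exact ((hd s x).const_mul (k x y)).mul (hd s y)
  have outer := hasDerivAt_intervalIntegral_of_continuous (a := a) (b := b)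
    (φ := fun s x => ∫ y in a..b, k x y * W s x * W s y)
    (φ' := fun s x => ∫ y in a..b, (k x y * W' s x * W s y + k x y * W s x * W' s y))
    (by
      refine intervalIntegral.continuous_parametric_intervalIntegral_of_continuous'
        (f := fun (p : ℝ × ℝ) y => k p.2 y * W p.1 p.2 * W p.1 y) ?_ a b
      exact ((hk2 (by fun_prop) (by fun_prop)).mul (hW2 (by fun_prop) (by fun_prop))).mul
        (hW2 (by fun_prop) (by fun_prop)))
    (by
      refine intervalIntegral.continuous_parametric_intervalIntegral_of_continuous'
        (f := fun (p : ℝ × ℝ) y => k p.2 y * W' p.1 p.2 * W p.1 y + k p.2 y * W p.1 p.2 * W' p.1 y)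
        ?_ a b
      exact (((hk2 (by fun_prop) (by fun_prop)).mul (hW2' (by fun_prop) (by fun_prop))).mul
        (hW2 (by fun_prop) (by fun_prop))).add
        (((hk2 (by fun_prop) (by fun_prop)).mul (hW2 (by fun_prop) (by fun_prop))).mul
        (hW2' (by fun_prop) (by fun_prop))))
    inner t
  convert outer using 1
  have hP : Continuous (Function.uncurry fun x y => k x y * W' t x * W t y) :=
    ((hk2 (by fun_prop) (by fun_prop)).mul (hW2' (by fun_prop) (by fun_prop))).mul
        (hW2 (by fun_prop) (by fun_prop))
  have hQ : Continuous (Function.uncurry fun x y => k x y * W t x * W' t y) :=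
    ((hk2 (by fun_prop) (by fun_prop)).mul (hW2 (by fun_prop) (by fun_prop))).mul
        (hW2' (by fun_prop) (by fun_prop))
  have hsec : ∀ {ψ : ℝ → ℝ → ℝ}, Continuous ψ.uncurry → ∀ s, Continuous (ψ s) :=
    fun hψ s => hψ.comp (Continuous.prodMk_right s)
  have hpar : ∀ {ψ : ℝ → ℝ → ℝ}, Continuous ψ.uncurry → Continuous fun x => ∫ y in a..b, ψ x y :=
    fun hψ => intervalIntegral.continuous_parametric_intervalIntegral_of_continuous' hψ a b
  have hswap : (∫ x in a..b, ∫ y in a..b, k x y * W t x * W' t y) =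
      ∫ x in a..b, ∫ y in a..b, k x y * W' t x * W t y := by
    rw [intervalIntegral_intervalIntegral_swap]
    · refine intervalIntegral.integral_congr fun x _ => intervalIntegral.integral_congr fun y _ => ?_
      simp only [hsymm y x]
      ring
    · exact (hQ.continuousOn.integrableOn_compact
        (isCompact_uIcc.prod isCompact_uIcc)).mono_set
        (prod_mono uIoc_subset_uIcc uIoc_subset_uIcc)
  have hsplit : (∫ x in a..b, ∫ y in a..b, (k x y * W' t x * W t y + k x y * W t x * W' t y)) =
      (∫ x in a..b, ∫ y in a..b, k x y * W' t x * W t y) +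
        ∫ x in a..b, ∫ y in a..b, k x y * W t x * W' t y := by
    rw [← intervalIntegral.integral_add ((hpar hP).intervalIntegrable a b)
      ((hpar hQ).intervalIntegrable a b)]
    exact intervalIntegral.integral_congr fun x _ => intervalIntegral.integral_add
      ((hsec hP x).intervalIntegrable a b) ((hsec hQ x).intervalIntegrable a b)
  rw [hsplit, hswap, ← two_mul]
  congr 1
  refine intervalIntegral.integral_congr fun x _ => ?_
  simp only [← intervalIntegral.integral_const_mul]
  exact intervalIntegral.integral_congr fun y _ => by ring

/-- If `W'` is a negative multiple of `Z * W` and the weighted average of `Z` against the quadratic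
form is smaller than the one against `W`, then the quotient of the quadratic form by the square of
the integral has positive derivative. -/
theorem deriv_integral_integral_div_sq_pos {a b : ℝ} {W W' k : ℝ → ℝ → ℝ} {Z : ℝ → ℝ} {h : ℝ}
    (hab : a ≤ b) (hh : 0 < h)
    (hW : Continuous W.uncurry) (hW' : Continuous W'.uncurry) (hk : Continuous k.uncurry)
    (hsymm : ∀ x y, k x y = k y x)
    (hd : ∀ t x, HasDerivAt (fun s => W s x) (W' t x) t)
    (hWZ : ∀ x ∈ Icc a b, W' h x = -(1 / h) * (Z x * W h x))
    (hWpos : 0 < ∫ x in a..b, W h x)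
    (hlt : (∫ x in a..b, Z x * (W h x * ∫ y in a..b, k x y * W h y)) * (∫ x in a..b, W h x) <
      (∫ x in a..b, Z x * W h x) * (∫ x in a..b, W h x * ∫ y in a..b, k x y * W h y)) :
    0 < deriv (fun t => (∫ x in a..b, ∫ y in a..b, k x y * W t x * W t y) /
      (∫ x in a..b, W t x) ^ 2) h := by
  have hN := hasDerivAt_integral_integral_symm (a := a) (b := b) hW hW' hk hsymm hd h
  have hD := hasDerivAt_intervalIntegral_of_continuous (a := a) (b := b) hW hW' hd h
  have hN0 : (∫ x in a..b, ∫ y in a..b, k x y * W h x * W h y) =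
      ∫ x in a..b, W h x * ∫ y in a..b, k x y * W h y := by
    refine intervalIntegral.integral_congr fun x _ => ?_
    simp only [← intervalIntegral.integral_const_mul]
    exact intervalIntegral.integral_congr fun y _ => by ring
  have hN1 : (∫ x in a..b, W' h x * ∫ y in a..b, k x y * W h y) =
      -(1 / h) * ∫ x in a..b, Z x * (W h x * ∫ y in a..b, k x y * W h y) := by
    rw [← intervalIntegral.integral_const_mul]
    refine intervalIntegral.integral_congr fun x hx => ?_
    rw [uIcc_of_le hab] at hx
    simp only [hWZ x hx]
    ring
  have hD1 : (∫ x in a..b, W' h x) = -(1 / h) * ∫ x in a..b, Z x * W h x := by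
    rw [← intervalIntegral.integral_const_mul]
    exact intervalIntegral.integral_congr fun x hx => hWZ x (by rwa [uIcc_of_le hab] at hx)
  have hq := hN.fun_div (hD.fun_pow 2) (pow_ne_zero 2 hWpos.ne')
  rw [hq.deriv, hN0, hN1, hD1]
  set A := ∫ x in a..b, Z x * (W h x * ∫ y in a..b, k x y * W h y)
  set B := ∫ x in a..b, W h x * ∫ y in a..b, k x y * W h y
  set C := ∫ x in a..b, Z x * W h x
  set D := ∫ x in a..b, W h x
  refine div_pos ?_ (by positivity)
  have : 0 < 2 / h * D * (C * B - A * D) := by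
    have := sub_pos.2 hlt
    positivity
  refine this.trans_eq ?_
  push_cast
  ring

/-- A function which is continuously differentiable on a half-line can be modified to the left of
any of its points so as to become continuously differentiable on the whole line. -/
theorem exists_hasDerivAt_extension {f f' : ℝ → ℝ} {η : ℝ} (hη : 0 < η)
    (hderiv : ∀ v ∈ Ioi (0 : ℝ), HasDerivAt f (f' v) v) (hf'c : ContinuousOn f' (Ioi 0)) :
    ∃ F F' : ℝ → ℝ, Continuous F' ∧ (∀ v, HasDerivAt F (F' v) v) ∧
      ∀ v, η ≤ v → F v = f v ∧ F' v = f' v := by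
  have hc : Continuous fun s => f' (max s η) :=
    hf'c.comp_continuous (by fun_prop) fun s => lt_max_of_lt_right hη
  refine ⟨fun v => f η + ∫ s in η..v, f' (max s η), fun s => f' (max s η), hc, fun v => ?_,
    fun v hv => ⟨?_, by simp only [max_eq_left hv]⟩⟩
  · exact (hc.integral_hasStrictDerivAt η v).hasDerivAt.const_add _
  · have : (∫ s in η..v, f' (max s η)) = f v - f η := by
      refine intervalIntegral.integral_eq_sub_of_hasDerivAt (fun s hs => ?_)
        (hc.intervalIntegrable _ _)
      rw [uIcc_of_le hv] at hs
      rw [max_eq_left hs.1]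
      exact hderiv s (hη.trans_le hs.1)
    simp only [this]
    ring

/-- A point `b > a` close enough to `a`, and a scale `h`, placing `[a ^ 2, b ^ 2]` and
`[a ^ 2 * h, a * b * h]` in prescribed intervals. -/
theorem exists_cutoffs {m M c d : ℝ} (hm : 0 < m) (hmM : m < M) (hc : 0 < c) (hcd : c < d) :
    ∃ a b h : ℝ, 0 < a ∧ Real.sqrt m ≤ a ∧ a < b ∧ b ≤ Real.sqrt M ∧ c / d ≤ a / b ∧ 0 < h ∧
      c ≤ a ^ 2 * h ∧ a * b * h ≤ d := by
  have ha : 0 < Real.sqrt m := Real.sqrt_pos.2 hm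
  have hd : 0 < d := hc.trans hcd
  set a := Real.sqrt m
  have hab : a < min (Real.sqrt M) (a * (d / c)) :=
    lt_min (Real.sqrt_lt_sqrt hm.le hmM) (lt_mul_of_one_lt_right ha ((one_lt_div hc).2 hcd))
  set b := min (Real.sqrt M) (a * (d / c))
  have hb : 0 < b := ha.trans hab
  have hbc : b * c ≤ a * d := by
    have : b ≤ a * (d / c) := min_le_right _ _
    rwa [← mul_div_assoc, le_div_iff₀ hc] at this
  refine ⟨a, b, c / a ^ 2, ha, le_rfl, hab, min_le_left _ _, ?_, by positivity, ?_, ?_⟩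
  · rw [div_le_div_iff₀ hd hb]
    linarith
  · exact (mul_div_cancel₀ c (by positivity)).ge
  · have : a * b * (c / a ^ 2) = b * c / a := by
      field_simp
    rw [this, div_le_iff₀ ha]
    linarith

theorem clustering_not_antitone_when_F4_fails
    (f f' : ℝ → ℝ)
    (hderiv : ∀ v ∈ Ioi (0:ℝ), HasDerivAt f (f' v) v)
    (hf'c : ContinuousOn f' (Ioi 0))
    (hfpos : ∀ v ∈ Ioi (0:ℝ), 0 < f v)
    (z : ℝ → ℝ) (hz : ∀ v : ℝ, z v = -v * f' v / f v)
    (u₀ ε : ℝ) (hε : 0 < ε) (hεu₀ : ε < u₀)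
    (hinc : StrictMonoOn (fun u => u * f u) (Icc (u₀ - ε) (u₀ + ε)))
    (v₀ δ : ℝ) (hδ : 0 < δ) (hδv₀ : δ < v₀)
    (hzdec : StrictAntiOn z (Icc (v₀ - δ) (v₀ + δ))) :
    ∀ τ : ℝ, ∃ a b h : ℝ,
      Real.sqrt (u₀ - ε) ≤ a ∧ a < b ∧ b ≤ Real.sqrt (u₀ + ε) ∧
      (v₀ - δ) / (v₀ + δ) ≤ a / b ∧
      0 < h ∧ v₀ - δ ≤ a ^ 2 * h ∧ a * b * h ≤ v₀ + δ ∧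
      (∫ x in a..b, z (a * h * x) *
          (f (a * h * x) *
              (∫ y in a..b, f (a * h * y) * f (x * y) * (x * y) ^ (2 - τ)) /
            (∫ v in a..b, ∫ y in a..b,
              f (a * h * v) * f (a * h * y) * f (v * y) * (v * y) ^ (2 - τ)))) <
        (∫ x in a..b, z (a * h * x) *
          (f (a * h * x) * x ^ (1 - τ) /
            (∫ v in a..b, f (a * h * v) * v ^ (1 - τ)))) ∧
      0 < deriv (fun h' : ℝ =>
          (∫ x in a..b, ∫ y in a..b,
              (x * y) ^ (2 - τ) * f (a * h' * x) * f (a * h' * y) * f (x * y)) /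
            (∫ x in a..b, x ^ (1 - τ) * f (a * h' * x)) ^ 2) h := by
  intro τ
  obtain ⟨a, b, h, ha, hma, hab, hbM, hratio, hh, hlo, hhi⟩ :=
    exists_cutoffs (m := u₀ - ε) (M := u₀ + ε) (c := v₀ - δ) (d := v₀ + δ)
      (by linarith) (by linarith) (by linarith) (by linarith)
  have hb : 0 < b := ha.trans hab
  obtain ⟨F, F', hF'c, hFd, hFf⟩ := exists_hasDerivAt_extension
    (η := min (a ^ 2) (a ^ 2 * (h / 2))) (by positivity) hderiv hf'c
  have hFc : Continuous F := continuous_iff_continuousAt.2 fun v => (hFd v).continuousAt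
  have hxy : ∀ x ∈ Icc a b, ∀ y ∈ Icc a b, F (x * y) = f (x * y) := by
    intro x hx y hy
    refine (hFf _ ((min_le_left _ _).trans ?_)).1
    rw [sq]
    exact mul_le_mul hx.1 hy.1 ha.le (ha.le.trans hx.1)
  have htx : ∀ t, h / 2 ≤ t → ∀ x ∈ Icc a b,
      F (a * t * x) = f (a * t * x) ∧ F' (a * t * x) = f' (a * t * x) := by
    intro t ht x hx
    refine hFf _ ((min_le_right _ _).trans ?_)
    have : t * a ≤ t * x := mul_le_mul_of_nonneg_left hx.1 (by linarith)
    nlinarith [mul_le_mul_of_nonneg_left ht (sq_nonneg a), mul_le_mul_of_nonneg_left this ha.le]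
  have hhx : ∀ x ∈ Icc a b, F (a * h * x) = f (a * h * x) ∧ F' (a * h * x) = f' (a * h * x) :=
    htx h (by linarith)
  have hahx : ∀ x ∈ Icc a b, 0 < a * h * x := fun x hx => by
    have := ha.trans_le hx.1
    positivity
  have hmem : ∀ x ∈ Icc a b, a * h * x ∈ Icc (v₀ - δ) (v₀ + δ) := by
    intro x hx
    have hah : 0 ≤ a * h := by positivity
    constructor
    · nlinarith [mul_le_mul_of_nonneg_left hx.1 hah]
    · nlinarith [mul_le_mul_of_nonneg_left hx.2 hah]
  have hmem2 : ∀ x ∈ Icc a b, ∀ y ∈ Icc a b, x * y ∈ Icc (u₀ - ε) (u₀ + ε) := by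
    intro x hx y hy
    have h1 : u₀ - ε ≤ a ^ 2 := (Real.sqrt_le_left ha.le).1 hma
    have h2 : b ^ 2 ≤ u₀ + ε := (Real.le_sqrt hb.le (by linarith)).1 hbM
    rw [sq] at h1 h2
    exact ⟨h1.trans (mul_le_mul hx.1 hy.1 ha.le (ha.le.trans hx.1)),
      (mul_le_mul hx.2 hy.2 (ha.le.trans hy.1) hb.le).trans h2⟩
  set p : ℝ → ℝ := fun x => (max x a) ^ (1 - τ) with hp
  have hpc : Continuous p := (continuous_id.max continuous_const).rpow_const
    fun x => Or.inl (lt_max_of_lt_right ha).ne'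
  have hppos : ∀ x, 0 < p x := fun x => Real.rpow_pos_of_pos (lt_max_of_lt_right ha) _
  have hpx : ∀ x ∈ Icc a b, x ^ (1 - τ) = p x := fun x hx => by simp only [hp, max_eq_left hx.1]
  have hpow : ∀ x ∈ Icc a b, ∀ y ∈ Icc a b, (x * y) ^ (2 - τ) = p x * p y * (x * y) := by
    intro x hx y hy
    have hx0 : 0 < x := ha.trans_le hx.1
    have hy0 : 0 < y := ha.trans_le hy.1
    rw [← hpx x hx, ← hpx y hy, ← Real.mul_rpow hx0.le hy0.le,
      ← Real.rpow_add_one (mul_pos hx0 hy0).ne']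
    congr 1
    ring
  set W : ℝ → ℝ → ℝ := fun t x => p x * F (a * t * x) with hWdef
  set W' : ℝ → ℝ → ℝ := fun t x => p x * (F' (a * t * x) * (a * x)) with hW'def
  set k : ℝ → ℝ → ℝ := fun x y => x * y * F (x * y) with hkdef
  have hW : Continuous W.uncurry := by
    simp only [hWdef, Function.uncurry_def]
    fun_prop
  have hW' : Continuous W'.uncurry := by
    simp only [hW'def, Function.uncurry_def]
    fun_prop
  have hk : Continuous k.uncurry := by
    simp only [hkdef, Function.uncurry_def]
    fun_prop
  have hWh : Continuous (W h) := hW.comp (Continuous.prodMk_right h)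
  have hd : ∀ t x, HasDerivAt (fun s => W s x) (W' t x) t := by
    intro t x
    have : HasDerivAt (fun s => a * s * x) (a * x) t := by
      simpa using ((hasDerivAt_id t).const_mul a).mul_const x
    exact ((hFd (a * t * x)).comp t this).const_mul (p x)
  have hWpos : ∀ x ∈ Icc a b, 0 < W h x := fun x hx =>
    mul_pos (hppos x) ((hhx x hx).1 ▸ hfpos _ (hahx x hx))
  have hG : Continuous fun x => ∫ y in a..b, k x y * W h y :=
    intervalIntegral.continuous_parametric_intervalIntegral_of_continuous'
      (f := fun x y => k x y * W h y) (hk.mul (hWh.comp continuous_snd)) a b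
  have hGmono : StrictMonoOn (fun x => ∫ y in a..b, k x y * W h y) (Icc a b) := by
    intro x₁ hx₁ x₂ hx₂ hlt
    have hpt : ∀ y ∈ Icc a b, k x₁ y * W h y < k x₂ y * W h y := by
      intro y hy
      refine mul_lt_mul_of_pos_right ?_ (hWpos y hy)
      simp only [hkdef, hxy x₁ hx₁ y hy, hxy x₂ hx₂ y hy]
      exact hinc (hmem2 x₁ hx₁ y hy) (hmem2 x₂ hx₂ y hy)
        (mul_lt_mul_of_pos_right hlt (ha.trans_le hy.1))
    have hkx : ∀ x, Continuous fun y => k x y * W h y := fun x =>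
      (hk.comp (Continuous.prodMk_right x)).mul hWh
    exact intervalIntegral.integral_lt_integral_of_continuousOn_of_le_of_exists_lt hab
      (hkx x₁).continuousOn (hkx x₂).continuousOn
      (fun y hy => (hpt y (Ioc_subset_Icc_self hy)).le)
      ⟨a, left_mem_Icc.2 hab.le, hpt a (left_mem_Icc.2 hab.le)⟩
  have hZc : ContinuousOn (fun x => z (a * h * x)) (Icc a b) := by
    have hzc : ContinuousOn z (Ioi 0) := by
      have hfc : ContinuousOn f (Ioi 0) := fun v hv => (hderiv v hv).continuousAt.continuousWithinAt
      rw [funext hz]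
      exact (continuousOn_neg.mul hf'c).div hfc fun v hv => (hfpos v hv).ne'
    exact hzc.comp (by fun_prop) fun x hx => hahx x hx
  have hZanti : StrictAntiOn (fun x => z (a * h * x)) (Icc a b) := fun x hx y hy hlt =>
    hzdec (hmem x hx) (hmem y hy) (mul_lt_mul_of_pos_left hlt (by positivity))
  have hlt := integral_mul_mul_integral_lt_of_strictAntiOn_of_strictMonoOn hab hWh.continuousOn
    hZc hG.continuousOn hWpos hZanti hGmono
  have hDpos : 0 < ∫ x in a..b, W h x :=
    intervalIntegral.intervalIntegral_pos_of_pos_on (hWh.intervalIntegrable a b)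
      (fun x hx => hWpos x (Ioo_subset_Icc_self hx)) hab
  have hGpos : ∀ x ∈ Icc a b, 0 < ∫ y in a..b, k x y * W h y := by
    intro x hx
    refine intervalIntegral.intervalIntegral_pos_of_pos_on
      (((hk.comp (Continuous.prodMk_right x)).mul hWh).intervalIntegrable a b)
      (fun y hy => ?_) hab
    have hy := Ioo_subset_Icc_self hy
    have hxy0 : 0 < x * y := mul_pos (ha.trans_le hx.1) (ha.trans_le hy.1)
    refine mul_pos (mul_pos hxy0 ?_) (hWpos y hy)
    rw [hxy x hx y hy]
    exact hfpos _ hxy0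
  have hNpos : 0 < ∫ x in a..b, W h x * ∫ y in a..b, k x y * W h y :=
    intervalIntegral.intervalIntegral_pos_of_pos_on ((hWh.mul hG).intervalIntegrable a b)
      (fun x hx => mul_pos (hWpos x (Ioo_subset_Icc_self hx)) (hGpos x (Ioo_subset_Icc_self hx)))
      hab
  have hcongr : ∀ {u v : ℝ → ℝ}, (∀ x ∈ Icc a b, u x = v x) →
      (∫ x in a..b, u x) = ∫ x in a..b, v x := fun huv =>
    intervalIntegral.integral_congr fun x hx => huv x (by rwa [uIcc_of_le hab.le] at hx)
  have hnum : ∀ x ∈ Icc a b,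
      f (a * h * x) * (∫ y in a..b, f (a * h * y) * f (x * y) * (x * y) ^ (2 - τ)) =
        W h x * ∫ y in a..b, k x y * W h y := by
    intro x hx
    simp only [← intervalIntegral.integral_const_mul]
    refine hcongr fun y hy => ?_
    simp only [hWdef, hkdef, hpow x hx y hy, hxy x hx y hy, (hhx x hx).1, (hhx y hy).1]
    ring
  have hden : (∫ v in a..b, ∫ y in a..b,
      f (a * h * v) * f (a * h * y) * f (v * y) * (v * y) ^ (2 - τ)) =
        ∫ x in a..b, W h x * ∫ y in a..b, k x y * W h y := by
    refine hcongr fun x hx => ?_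
    rw [← hnum x hx, ← intervalIntegral.integral_const_mul]
    exact hcongr fun y _ => by ring
  have hwt : ∀ x ∈ Icc a b, f (a * h * x) * x ^ (1 - τ) = W h x := by
    intro x hx
    simp only [hWdef, hpx x hx, (hhx x hx).1]
    ring
  refine ⟨a, b, h, hma, hab, hbM, hratio, hh, hlo, hhi, ?_, ?_⟩
  · have hL : ∀ x ∈ Icc a b, z (a * h * x) * (f (a * h * x) *
        (∫ y in a..b, f (a * h * y) * f (x * y) * (x * y) ^ (2 - τ)) /
          (∫ x in a..b, W h x * ∫ y in a..b, k x y * W h y)) =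
        z (a * h * x) * (W h x * ∫ y in a..b, k x y * W h y) /
          ∫ x in a..b, W h x * ∫ y in a..b, k x y * W h y := fun x hx => by
      rw [hnum x hx, ← mul_div_assoc]
    have hR : ∀ x ∈ Icc a b, z (a * h * x) * (f (a * h * x) * x ^ (1 - τ) /
        ∫ x in a..b, W h x) = z (a * h * x) * W h x / ∫ x in a..b, W h x := fun x hx => by
      rw [hwt x hx, ← mul_div_assoc]
    rw [hden, hcongr hwt, hcongr hL, hcongr hR, intervalIntegral.integral_div,
      intervalIntegral.integral_div, div_lt_div_iff₀ hNpos hDpos]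
    exact hlt
  · have hpos := deriv_integral_integral_div_sq_pos hab.le hh hW hW' hk
      (fun x y => by simp only [hkdef, mul_comm x y]) hd (Z := fun x => z (a * h * x))
      (fun x hx => by
        have hf0 := (hfpos _ (hahx x hx)).ne'
        simp only [hWdef, hW'def, hz, (hhx x hx).1, (hhx x hx).2]
        field_simp) hDpos hlt
    refine hpos.trans_eq (Filter.EventuallyEq.deriv_eq ?_)
    filter_upwards [Ici_mem_nhds (half_lt_self hh)] with t ht
    congr 1
    · refine hcongr fun x hx => hcongr fun y hy => ?_
      simp only [hWdef, hkdef, hpow x hx y hy, hxy x hx y hy, (htx t ht x hx).1, (htx t ht y hy).1]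
      ring
    · congr 1
      refine hcongr fun x hx => ?_
      simp only [hWdef, hpx x hx, (htx t ht x hx).1]
end
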